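/- Let α, β, μ, ν be real and k an integer, and suppose α ∉ ℤ and β ∉ ℤ if k = 1. Let τ ∈ ℂ with Re τ > 0, q := e^{−2πτ}, q̂ := e^{−2π/τ}. Then e(αμ)·( δ(β)·ψ(k,−μ,α) + 𝒮_k(β,−μ;ν,α;q) + (−1)^{k−1}·𝒮_k(−β,μ;−ν,−α;q) ) − (−2π)^k·Σ_{j=0}^{k+1} ((−i)^j·𝒞_j(⟨α⟩,μ)·𝒞_{k+1−j}(⟨β⟩,ν)/(j!(k+1−j)!))·τ^{k−j} = e(βν)·(−iτ)^{k−1}·( δ(α)·ψ(k,ν,−β) + 𝒮_k(α,ν;μ,−β;q̂) + (−1)^{k−1}·𝒮_k(−α,−ν;−μ,β;q̂) ), where the sum over j is empty if k+1 < 0, and the powers (−iτ)^{k−1}, τ^{k−j} are integer powers. -/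

import Mathlib

noncomputable section

open Complex MeasureTheory
open scoped Real Classical

/-- `e(s) = exp(2 π i s)`. -/
def ee (s : ℂ) : ℂ := Complex.exp (2 * (Real.pi : ℂ) * Complex.I * s)

/-- `δ(x) = 1` if `x ∈ ℤ`, `0` otherwise. -/
def dInt (x : ℝ) : ℂ := if ∃ n : ℤ, (n : ℝ) = x then 1 else 0

/-- The Lerch zeta function `ψ(r,γ,κ) = Σ_{k ∈ ℤ, γ+k>0} e((γ+k)κ) (γ+k)^{-r}`
(a convergent series when `Re r > 1`). -/
def psiL (r : ℂ) (γ κ : ℝ) : ℂ :=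
  ∑' k : {k : ℤ // 0 < γ + (k : ℝ)},
    ee ((((γ + (k.1 : ℝ)) * κ : ℝ)) : ℂ) * (((γ + (k.1 : ℝ)) : ℝ) : ℂ) ^ (-r)

/-- The `q`-series `𝒮_r(γ,δ;κ,λ;q)`, where `q = e^{-2πt}` with `Re t > 0`, and the power
`q^{(γ+k)(δ+l)}` is interpreted as `exp (-2πt(γ+k)(δ+l))`. -/
def Scal (r : ℂ) (γ δ' κ lam : ℝ) (t : ℂ) : ℂ :=
  ∑' (k : {k : ℤ // 0 < γ + (k : ℝ)}) (l : {l : ℤ // 0 < δ' + (l : ℝ)}),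
    ee ((((γ + (k.1 : ℝ)) * κ + (δ' + (l.1 : ℝ)) * lam : ℝ)) : ℂ) *
      (((δ' + (l.1 : ℝ)) : ℝ) : ℂ) ^ (-r) *
      Complex.exp (-2 * (Real.pi : ℂ) * t * ((γ + (k.1 : ℝ) : ℝ) : ℂ) * ((δ' + (l.1 : ℝ) : ℝ) : ℂ))

/-- The generalized Eisenstein series `F_{ℤ²}(s;α,β;μ,ν;z)` (mean of the two branch
conventions), defined by an absolutely convergent series for `Re s > 2`. -/
def Fz2 (s : ℂ) (α β μ ν : ℝ) (z : ℂ) : ℂ :=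
  (∑' p : {p : ℤ × ℤ // β + (p.2 : ℝ) ≠ 0},
      ee ((((α + (p.1.1 : ℝ)) * μ + (β + (p.1.2 : ℝ)) * ν : ℝ)) : ℂ) *
        ((((α + (p.1.1 : ℝ)) : ℝ) : ℂ) + (((β + (p.1.2 : ℝ)) : ℝ) : ℂ) * z) ^ (-s)) +
  dInt β *
    ((∑' m : {m : ℤ // 0 < α + (m : ℝ)},
        ee ((((α + (m.1 : ℝ)) * μ : ℝ)) : ℂ) * (((α + (m.1 : ℝ)) : ℝ) : ℂ) ^ (-s)) +
      Complex.cos ((Real.pi : ℂ) * s) *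
        ∑' m : {m : ℤ // α + (m : ℝ) < 0},
          ee ((((α + (m.1 : ℝ)) * μ : ℝ)) : ℂ) * ((|α + (m.1 : ℝ)| : ℝ) : ℂ) ^ (-s))

/-- `𝒜(s,α,μ) = cos(πs) ψ(s,-α,-μ) + ψ(s,α,μ)`. -/
def Acal (s : ℂ) (α μ : ℝ) : ℂ :=
  Complex.cos ((Real.pi : ℂ) * s) * psiL s (-α) (-μ) + psiL s α μ

/-- `ψ(k,γ,κ)` at an integer `k`: the convergent series for `k ≥ 2`, the value
`-𝒞_{1-k}(⟨γ⟩,κ)/(1-k) - δ_{k0} δ(γ)` of the analytic continuation for `k ≤ 0`,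
and the (irrelevant) value `0` for `k = 1`; here `C` is the family of Taylor
coefficients `𝒞`. -/
def psiIntC (C : ℕ → ℂ → ℝ → ℂ) (k : ℤ) (γ κ : ℝ) : ℂ :=
  if 2 ≤ k then
    ∑' n : {n : ℤ // 0 < γ + (n : ℝ)},
      ee ((((γ + (n.1 : ℝ)) * κ : ℝ)) : ℂ) * (((γ + (n.1 : ℝ)) : ℝ) : ℂ) ^ (-k)
  else if k ≤ 0 then
    -C (1 - k).toNat ((Int.fract γ : ℝ) : ℂ) κ / ((1 : ℂ) - (k : ℂ)) -
      (if k = 0 then dInt γ else 0)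
  else 0

/-- The Bernoulli polynomial `B_j(x)` evaluated in `ℂ`. -/
def BpolyC (j : ℕ) (x : ℂ) : ℂ := Polynomial.aeval x (Polynomial.bernoulli j)

/-- Weierstrass `℘`-function with periods `(1, z)`. -/
def wpFn (z w : ℂ) : ℂ :=
  w ^ (-2 : ℤ) + ∑' p : {p : ℤ × ℤ // p ≠ (0, 0)},
    ((w - (p.1.1 : ℂ) - (p.1.2 : ℂ) * z) ^ (-2 : ℤ) -
      ((p.1.1 : ℂ) + (p.1.2 : ℂ) * z) ^ (-2 : ℤ))

/-- Weierstrass zeta function with periods `(1, z)`. -/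
def wzetaFn (z w : ℂ) : ℂ :=
  1 / w + ∑' p : {p : ℤ × ℤ // p ≠ (0, 0)},
    (1 / (w - (p.1.1 : ℂ) - (p.1.2 : ℂ) * z) + 1 / ((p.1.1 : ℂ) + (p.1.2 : ℂ) * z) +
      w / ((p.1.1 : ℂ) + (p.1.2 : ℂ) * z) ^ 2)

/-- Weierstrass sigma function with periods `(1, z)`. -/
def wsigmaFn (z w : ℂ) : ℂ :=
  w * ∏' p : {p : ℤ × ℤ // p ≠ (0, 0)},
    ((1 - w / ((p.1.1 : ℂ) + (p.1.2 : ℂ) * z)) *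
      Complex.exp (w / ((p.1.1 : ℂ) + (p.1.2 : ℂ) * z) +
        w ^ 2 / (2 * ((p.1.1 : ℂ) + (p.1.2 : ℂ) * z) ^ 2)))

/-- The `q`-Pochhammer symbol `(Z;q)_∞`. -/
def qPoch (Z q : ℂ) : ℂ := ∏' l : ℕ, (1 - Z * q ^ l)

/-- `⟨x⟩' = 1 - ⟨-x⟩`. -/
def fracP (x : ℝ) : ℝ := 1 - Int.fract (-x)

/-- The Eisenstein series `E₂`. -/
def E2cl (z : ℂ) : ℂ := 1 - 24 * ∑' l : ℕ+, (l : ℂ) * ee z ^ (l : ℕ) / (1 - ee z ^ (l : ℕ))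

/-- `a_{2k}`: `ζ(1-2k)` for `k ≠ 0` and `2ζ'(0) = -log 2π` for `k = 0`. -/
def acoef (k : ℤ) : ℂ :=
  if k = 0 then -(Real.log (2 * Real.pi) : ℂ) else riemannZeta ((1 - 2 * k : ℤ) : ℂ)

/-- The classical Eisenstein series `E_{2k}`. -/
def Ecl (k : ℤ) (z : ℂ) : ℂ :=
  1 + (2 / acoef k) * ∑' l : ℕ+, (l : ℂ) ^ (2 * k - 1) * ee z ^ (l : ℕ) / (1 - ee z ^ (l : ℕ))

/-- The bilateral Lerch zeta function `ψ_ℤ^ε(r,γ,κ) = e^{-επir} ψ(r,-γ,-κ) + ψ(r,γ,κ)`. -/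
def psiZpm (ε : ℤ) (r : ℂ) (γ κ : ℝ) : ℂ :=
  Complex.exp (-(ε : ℂ) * (Real.pi : ℂ) * Complex.I * r) * psiL r (-γ) (-κ) + psiL r γ κ

/-! ### The additive character -/

lemma ee_add (s t : ℂ) : ee (s + t) = ee s * ee t := by
  simp only [ee, mul_add, Complex.exp_add]

lemma ee_zero : ee 0 = 1 := by simp [ee]

lemma ee_int (n : ℤ) : ee n = 1 := by
  rw [ee, mul_comm, Complex.exp_int_mul_two_pi_mul_I]

lemma ee_ne_zero (s : ℂ) : ee s ≠ 0 := Complex.exp_ne_zero _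

lemma ee_neg (s : ℂ) : ee (-s) = (ee s)⁻¹ := by
  simp only [ee, mul_neg, Complex.exp_neg]

lemma norm_ee (x : ℝ) : ‖ee x‖ = 1 := by
  rw [ee, show 2 * (π : ℂ) * I * x = ((2 * π * x : ℝ) : ℂ) * I by push_cast; ring,
    Complex.norm_exp_ofReal_mul_I]

lemma ee_eq_one_iff (s : ℂ) : ee s = 1 ↔ ∃ n : ℤ, s = n := by
  rw [ee, Complex.exp_eq_one_iff]
  refine exists_congr fun n => ⟨fun h => ?_, fun h => by rw [h]; ring⟩
  have : (2 * (π : ℂ) * I) ≠ 0 := Complex.two_pi_I_ne_zero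
  exact mul_left_cancel₀ this (by rw [h]; ring)

lemma continuous_ee : Continuous ee := by unfold ee; fun_prop

/-- The generating function `e^{xZ} / (e(m) e^Z - 1)`. -/
def genFun (x m : ℝ) (Z : ℂ) : ℂ := Complex.exp (x * Z) / (ee m * Complex.exp Z - 1)

/-- A sequence of functions with the derivative and jump relations of the Taylor coefficients
of `Z * genFun x m Z`. -/
structure IsAppell (m : ℝ) (p : ℕ → ℝ → ℂ) : Prop where
  deriv_zero : ∀ x, HasDerivAt (p 0) 0 x
  deriv_succ : ∀ j x, HasDerivAt (p (j + 1)) (p j x) x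
  jump : ∀ j, ee m * p j 1 - p j 0 = if j = 1 then 1 else 0

lemma taylor_unique {a b : ℕ → ℂ} {f : ℂ → ℂ}
    (ha : ∀ᶠ Z in nhdsWithin (0 : ℂ) {(0 : ℂ)}ᶜ, HasSum (fun j => a j * Z ^ j) (f Z))
    (hb : ∀ᶠ Z in nhdsWithin (0 : ℂ) {(0 : ℂ)}ᶜ, HasSum (fun j => b j * Z ^ j) (f Z)) :
    a = b := by
  set d : ℕ → ℂ := fun j => a j - b j
  have hd : ∀ᶠ Z in nhdsWithin (0 : ℂ) {(0 : ℂ)}ᶜ, HasSum (fun j => d j * Z ^ j) 0 := by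
    filter_upwards [ha, hb] with Z h1 h2
    simpa [d, sub_mul] using h1.sub h2
  set f : ℂ → ℂ := fun Z => if Z = 0 then d 0 else 0
  have hf : HasFPowerSeriesAt f (FormalMultilinearSeries.ofScalars ℂ d) 0 := by
    rw [hasFPowerSeriesAt_iff']
    rw [eventually_nhdsWithin_iff] at hd
    filter_upwards [hd] with Z hZ
    by_cases h0 : Z = 0
    · subst h0
      simp only [f, sub_zero, if_true]
      convert! hasSum_single (α := ℂ) 0 _ using 1
      · simp
      · intro n hn; simp [hn]
    · simpa [f, h0, mul_comm] using hZ h0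
  have hd0 : d 0 = 0 := by
    have h1 : Filter.Tendsto f (nhdsWithin (0 : ℂ) {(0 : ℂ)}ᶜ) (nhds (f 0)) :=
      hf.continuousAt.tendsto.mono_left nhdsWithin_le_nhds
    have h2 : Filter.Tendsto f (nhdsWithin (0 : ℂ) {(0 : ℂ)}ᶜ) (nhds 0) := by
      refine tendsto_const_nhds.congr' ?_
      filter_upwards [self_mem_nhdsWithin] with Z hZ
      simp [f, show Z ≠ 0 from hZ]
    simpa [f] using tendsto_nhds_unique h1 h2
  have hf0 : f = 0 := by
    ext Z; by_cases h : Z = 0 <;> simp [f, h, hd0]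
  rw [hf0] at hf
  have hz := hf.eq_zero
  ext j
  have := congrArg (fun p => p.coeff j) hz
  rw [FormalMultilinearSeries.coeff_ofScalars] at this
  exact sub_eq_zero.mp this

/-- Taylor coefficients of `Z * genFun x m Z`, expressed through those at `x = 0`. -/
def bern (C : ℕ → ℂ → ℝ → ℂ) (m : ℝ) (j : ℕ) (x : ℝ) : ℂ :=
  ∑ i ∈ Finset.range (j + 1),
    C i 0 m / (Nat.factorial i : ℂ) * ((x : ℂ) ^ (j - i) / (Nat.factorial (j - i) : ℂ))

/-- The defining property of the Taylor coefficients `𝒞`. -/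
def IsTaylor (C : ℕ → ℂ → ℝ → ℂ) : Prop :=
  ∀ (X : ℂ) (κ : ℝ), ∀ᶠ Z in nhdsWithin (0 : ℂ) {(0 : ℂ)}ᶜ,
      HasSum (fun j : ℕ => C j X κ * Z ^ j / (Nat.factorial j : ℂ))
        (Z * ee (X * (κ : ℂ)) * Complex.exp (X * Z) / (ee ((κ : ℝ) : ℂ) * Complex.exp Z - 1))

lemma hasSum_bern {C : ℕ → ℂ → ℝ → ℂ} (hC : IsTaylor C) (m x : ℝ) :
    ∀ᶠ Z in nhdsWithin (0 : ℂ) {(0 : ℂ)}ᶜ, HasSum (fun j : ℕ => bern C m j x * Z ^ j) (Z * genFun x m Z) := by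
  filter_upwards [hC 0 m] with Z hZ
  have h1 := NormedSpace.expSeries_div_hasSum_exp ((x : ℂ) * Z)
  rw [← Complex.exp_eq_exp_ℂ] at h1
  have := hasSum_sum_range_mul_of_summable_norm hZ.summable.norm h1.summable.norm
  rw [hZ.tsum_eq, h1.tsum_eq] at this
  convert! this using 1
  · ext j
    rw [bern, Finset.sum_mul]
    refine Finset.sum_congr rfl fun i hi => ?_
    rw [mul_pow]
    have : Z ^ j = Z ^ i * Z ^ (j - i) := by
      rw [← pow_add]; congr 1; have := Finset.mem_range.mp hi; omega
    rw [this]; ring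
  · simp [genFun, ee_zero]; ring

lemma C_eq_bern {C : ℕ → ℂ → ℝ → ℂ} (hC : IsTaylor C) (m x : ℝ) (j : ℕ) :
    C j x m = ee ((x * m : ℝ) : ℂ) * (Nat.factorial j * bern C m j x) := by
  have := taylor_unique (a := fun j => C j x m / (Nat.factorial j : ℂ))
    (b := fun j => ee ((x * m : ℝ) : ℂ) * bern C m j x)
    (f := fun Z => Z * ee ((x * m : ℝ) : ℂ) * Complex.exp (x * Z) /
      (ee ((m : ℝ) : ℂ) * Complex.exp Z - 1)) ?_ ?_
  · have h := congrFun this j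
    have hj : (Nat.factorial j : ℂ) ≠ 0 := by exact_mod_cast Nat.factorial_ne_zero j
    rw [div_eq_iff hj] at h
    rw [h]; ring
  · filter_upwards [hC x m] with Z hZ
    push_cast
    convert! hZ using 2
    ring
  · filter_upwards [hasSum_bern hC m x] with Z hZ
    convert! hZ.mul_left (ee ((x * m : ℝ) : ℂ)) using 1
    · ext j; ring
    · simp only [genFun]; ring

lemma eventually_den_ne_zero (m : ℝ) : ∀ᶠ Z in nhdsWithin (0 : ℂ) {(0 : ℂ)}ᶜ,
    ee m * Complex.exp Z - 1 ≠ 0 := by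
  have h : HasDerivAt (fun Z : ℂ => ee m * Complex.exp Z) (ee m * Complex.exp 0) 0 :=
    (Complex.hasDerivAt_exp 0).const_mul _
  filter_upwards [h.eventually_ne (mul_ne_zero (ee_ne_zero _) (Complex.exp_ne_zero _)) (c := 1)]
    with Z hZ
  exact sub_ne_zero.mpr hZ

lemma isAppell_bern {C : ℕ → ℂ → ℝ → ℂ} (hC : IsTaylor C) (m : ℝ) : IsAppell m (bern C m) := by
  refine ⟨fun x => ?_, fun j x => ?_, fun j => ?_⟩
  · have : bern C m 0 = fun _ => C 0 0 m := by ext x; simp [bern]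
    rw [this]; exact hasDerivAt_const _ _
  · unfold bern
    have hx : HasDerivAt (fun x : ℝ => (x : ℂ)) 1 x := Complex.ofRealCLM.hasDerivAt
    have : ∀ i ∈ Finset.range (j + 2), HasDerivAt
        (fun x : ℝ => C i 0 m / (Nat.factorial i : ℂ) *
          ((x : ℂ) ^ (j + 1 - i) / (Nat.factorial (j + 1 - i) : ℂ)))
        (if i = j + 1 then 0 else C i 0 m / (Nat.factorial i : ℂ) *
          ((x : ℂ) ^ (j - i) / (Nat.factorial (j - i) : ℂ))) x := by
      intro i hi
      split_ifs with h
      · subst h; simpa using hasDerivAt_const x _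
      · obtain ⟨l, rfl⟩ : ∃ l, j = i + l :=
          ⟨j - i, by have := Finset.mem_range.mp hi; omega⟩
        have e1 : i + l + 1 - i = l + 1 := by omega
        have e2 : i + l - i = l := by omega
        rw [e1, e2]
        refine (((hx.fun_pow (l + 1)).div_const _).const_mul _).congr_deriv ?_
        have : (l + 1 : ℂ) ≠ 0 := by exact_mod_cast Nat.succ_ne_zero l
        have : (Nat.factorial l : ℂ) ≠ 0 := by exact_mod_cast Nat.factorial_ne_zero l
        rw [Nat.factorial_succ]; push_cast
        field_simp
    refine (HasDerivAt.fun_sum this).congr_deriv ?_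
    rw [Finset.sum_range_succ]
    simp only [if_true, add_zero]
    refine Finset.sum_congr rfl fun i hi => ?_
    rw [if_neg (by have := Finset.mem_range.mp hi; omega)]
  · refine congrFun (taylor_unique (a := fun j => ee m * bern C m j 1 - bern C m j 0)
      (b := fun j => if j = 1 then 1 else 0) (f := fun Z => Z) ?_ ?_) j
    · filter_upwards [hasSum_bern hC m 0, hasSum_bern hC m 1, eventually_den_ne_zero m]
        with Z h0 h1 hZ
      convert! (h1.mul_left (ee m)).sub h0 using 1
      · ext j; ring
      · simp only [genFun]; push_cast; field_simp; simp
    · refine Filter.Eventually.of_forall fun Z => ?_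
      convert! hasSum_ite_eq 1 Z using 1
      ext j; split_ifs with h <;> simp [h]

lemma IsAppell.zero_eq {m : ℝ} {p : ℕ → ℝ → ℂ} (hp : IsAppell m p) (x y : ℝ) :
    p 0 x = p 0 y :=
  is_const_of_deriv_eq_zero (fun z => (hp.deriv_zero z).differentiableAt)
    (fun z => (hp.deriv_zero z).deriv) x y

lemma IsAppell.continuous {m : ℝ} {p : ℕ → ℝ → ℂ} (hp : IsAppell m p) (j : ℕ) :
    Continuous (p j) := by
  refine continuous_iff_continuousAt.mpr fun x => ?_
  cases j with
  | zero => exact (hp.deriv_zero x).continuousAt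
  | succ j => exact (hp.deriv_succ j x).continuousAt

/-- The leading coefficient vanishes unless the character is trivial. -/
lemma IsAppell.zero_eq_ite {m : ℝ} {p : ℕ → ℝ → ℂ} (hp : IsAppell m p) (x : ℝ) :
    p 0 x = if ee m = 1 then 1 else 0 := by
  have h0 := hp.jump 0
  rw [hp.zero_eq 1 x, hp.zero_eq 0 x] at h0
  split_ifs with h
  · have h1 := hp.jump 1
    rw [h, one_mul, if_pos rfl] at h1
    have h2 : ∀ y, HasDerivAt (fun y : ℝ => p 1 y - y * p 0 x) 0 y := by
      intro y
      have hy : HasDerivAt (fun x : ℝ => (x : ℂ)) 1 y := Complex.ofRealCLM.hasDerivAt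
      refine ((hp.deriv_succ 0 y).fun_sub (hy.mul_const _)).congr_deriv ?_
      rw [hp.zero_eq y x]; ring
    have h3 := is_const_of_deriv_eq_zero (fun z => (h2 z).differentiableAt)
      (fun z => (h2 z).deriv) 1 0
    push_cast at h3
    linear_combination h1 - h3
  · have : (ee m - 1) * p 0 x = 0 := by simpa [sub_mul] using h0
    exact (mul_eq_zero.mp this).resolve_left (sub_ne_zero.mpr h)

/-! ### Summability over a shifted lattice -/

lemma tendsto_abs_add_int (c : ℝ) :
    Filter.Tendsto (fun n : ℤ => |c + n|) Filter.cofinite Filter.atTop := by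
  have h1 : Filter.Tendsto (fun n : ℤ => |(n : ℝ)|) Filter.cofinite Filter.atTop := by
    have := tendsto_norm_cocompact_atTop (E := ℝ) |>.comp Int.tendsto_coe_cofinite
    simpa [Function.comp_def] using this
  refine Filter.tendsto_atTop_mono (fun n => ?_) (Filter.tendsto_atTop_add_const_right _ (-|c|) h1)
  have := abs_sub (c + n) c
  rw [add_sub_cancel_left] at this
  linarith

lemma isBigO_zpow_mul_exp {k : ℤ} {δ : ℝ} (h : 0 < δ ∨ 0 ≤ δ ∧ 2 ≤ k) :
    (fun x : ℝ => x ^ (-k) * Real.exp (-δ * x)) =O[Filter.atTop] fun x => x ^ (-2 : ℝ) := by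
  rcases h with h | ⟨h0, hk⟩
  · have h1 := (isLittleO_exp_neg_mul_rpow_atTop h ((k : ℝ) - 2)).isBigO
    have h2 := (Asymptotics.isBigO_refl (fun x : ℝ => x ^ (-k)) Filter.atTop).mul h1
    refine h2.trans (Filter.EventuallyEq.isBigO ?_)
    filter_upwards [Filter.eventually_gt_atTop 0] with x hx
    rw [← Real.rpow_intCast, ← Real.rpow_add hx]
    congr 1; push_cast; ring
  · refine Asymptotics.IsBigO.of_bound 1 ?_
    filter_upwards [Filter.eventually_ge_atTop 1] with x hx
    have hx0 : 0 < x := by linarith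
    rw [← Real.rpow_intCast, one_mul, norm_mul, Real.norm_of_nonneg (Real.rpow_nonneg hx0.le _),
      Real.norm_of_nonneg (Real.exp_pos _).le, Real.norm_of_nonneg (Real.rpow_nonneg hx0.le _)]
    have h1 : Real.exp (-δ * x) ≤ 1 := Real.exp_le_one_iff.mpr (by nlinarith)
    have h2 : x ^ ((-k : ℤ) : ℝ) ≤ x ^ (-2 : ℝ) := by
      refine Real.rpow_le_rpow_of_exponent_le hx ?_
      have : ((-k : ℤ) : ℝ) ≤ ((-2 : ℤ) : ℝ) := by exact_mod_cast (by omega)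
      simpa using this
    calc _ ≤ x ^ ((-k : ℤ) : ℝ) * 1 := by
          refine mul_le_mul_of_nonneg_left h1 (Real.rpow_nonneg hx0.le _)
      _ ≤ _ := by rwa [mul_one]

/-- The bounding sequence used for all lattice sums. -/
def latBound (k : ℤ) (c δ : ℝ) (n : ℤ) : ℝ :=
  if c + n = 0 then 0 else |c + n| ^ (-k) * Real.exp (-δ * |c + n|)

lemma latBound_nonneg (k : ℤ) (c δ : ℝ) (n : ℤ) : 0 ≤ latBound k c δ n := by
  unfold latBound; split_ifs <;> positivity

lemma summable_latBound {k : ℤ} (c : ℝ) {δ : ℝ} (h : 0 < δ ∨ 0 ≤ δ ∧ 2 ≤ k) :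
    Summable (latBound k c δ) := by
  have h1 : Summable fun n : ℤ => 1 / |(n : ℝ) + c| ^ (2 : ℝ) :=
    (Real.summable_one_div_int_add_rpow c 2).mpr (by norm_num)
  refine summable_of_isBigO h1 ?_
  have h2 := (isBigO_zpow_mul_exp h).comp_tendsto (tendsto_abs_add_int c)
  refine Asymptotics.IsBigO.congr' h2 ?_ ?_
  · filter_upwards [(tendsto_abs_add_int c).eventually_gt_atTop 0] with n hn
    simp only [Function.comp, latBound]
    rw [if_neg (abs_pos.mp hn)]
  · refine Filter.Eventually.of_forall fun n => ?_
    simp only [Function.comp]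
    rw [Real.rpow_neg (abs_nonneg _), one_div, add_comm]

/-- The coefficient `e(y b) y^{-k}` at `y = c + n`, omitting `y = 0`. -/
def yterm (k : ℤ) (b c : ℝ) (n : ℤ) : ℂ :=
  if c + n = 0 then 0 else ee (((c + n) * b : ℝ) : ℂ) * ((c + n : ℝ) : ℂ) ^ (-k)

lemma norm_yterm (k : ℤ) (b c : ℝ) (n : ℤ) : ‖yterm k b c n‖ = latBound k c 0 n := by
  unfold yterm latBound
  split_ifs
  · simp
  · rw [norm_mul, norm_ee, norm_zpow, Complex.norm_real]; simp

lemma norm_yterm_mul_exp (k : ℤ) (b c δ : ℝ) (n : ℤ) :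
    ‖yterm k b c n‖ * Real.exp (-δ * |c + n|) = latBound k c δ n := by
  rw [norm_yterm]; unfold latBound; split_ifs <;> simp

/-! ### Fourier expansion of quasi-periodic functions -/

lemma hasSum_fourier_twisted {c : ℝ} {f : ℝ → ℂ} {a : ℤ → ℂ}
    (hf : ContinuousOn f (Set.Icc 0 1)) (hper : f 1 = ee c * f 0)
    (ha : ∀ n : ℤ, ∫ x in (0 : ℝ)..1, ee ((-((c + n) * x) : ℝ) : ℂ) * f x = a n)
    (hs : Summable a) {x : ℝ} (hx : x ∈ Set.Icc (0 : ℝ) 1) :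
    HasSum (fun n : ℤ => a n * ee (((c + n) * x : ℝ) : ℂ)) (f x) := by
  set g : ℝ → ℂ := fun x => ee ((-(c * x) : ℝ) : ℂ) * f x with hg
  have hgc : ContinuousOn g (Set.Icc 0 1) := by
    refine ContinuousOn.mul ?_ hf
    exact (continuous_ee.comp (by fun_prop)).continuousOn
  have hg01 : g 0 = g 1 := by
    simp only [hg, hper]
    rw [← mul_assoc, ← ee_add]; simp
  set F : C(AddCircle (1 : ℝ), ℂ) :=
    ⟨AddCircle.liftIco 1 0 g,
      AddCircle.liftIco_continuous (by simpa using hg01) (by simpa using hgc)⟩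
    with hF
  have hcoef : ∀ n, fourierCoeff F n = a n := by
    intro n
    rw [hF, ContinuousMap.coe_mk, fourierCoeff_liftIco_eq, fourierCoeffOn_eq_integral, ← ha n]
    simp only [zero_add, sub_zero, div_one, one_smul]
    refine intervalIntegral.integral_congr fun x _ => ?_
    simp only [hg, smul_eq_mul]
    rw [fourier_coe_apply, ← mul_assoc]
    congr 1
    simp only [ee]
    rw [← Complex.exp_add]; congr 1; push_cast; ring
  have key : ∀ x ∈ Set.Ico (0 : ℝ) 1,
      HasSum (fun n : ℤ => a n * ee (((c + n) * x : ℝ) : ℂ)) (f x) := by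
    intro x hx
    have h := has_pointwise_sum_fourier_series_of_summable (f := F)
      (by rw [show fourierCoeff F = a from funext hcoef]; exact hs) (x : AddCircle (1 : ℝ))
    have hFx : F (x : AddCircle (1 : ℝ)) = g x := by
      rw [hF, ContinuousMap.coe_mk, AddCircle.liftIco_coe_apply (by simpa using hx)]
    rw [hFx] at h
    convert! h.mul_left (ee ((c * x : ℝ) : ℂ)) using 1
    · ext n
      rw [hcoef, fourier_coe_apply]
      simp only [smul_eq_mul, ee]
      rw [mul_left_comm, ← Complex.exp_add]
      congr 2; push_cast; ring
    · simp only [hg]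
      rw [← mul_assoc, ← ee_add]; simp [ee_zero]
  rcases eq_or_lt_of_le hx.2 with rfl | h1
  · rw [hper]
    convert! (key 0 (by simp)).mul_left (ee c) using 1
    ext n
    have : ee ((((c + n) * 1 : ℝ)) : ℂ) = ee c := by
      rw [mul_one]; push_cast; rw [ee_add, ee_int, mul_one]
    rw [this]; simp [ee_zero]; ring
  · exact key x ⟨hx.1, h1⟩

lemma hasDerivAt_ee (a x : ℝ) : HasDerivAt (fun x : ℝ => ee ((a * x : ℝ) : ℂ))
    (2 * π * I * a * ee ((a * x : ℝ) : ℂ)) x := by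
  have hx : HasDerivAt (fun x : ℝ => (x : ℂ)) 1 x := Complex.ofRealCLM.hasDerivAt
  have h := (hx.const_mul (2 * π * I * a : ℂ)).cexp
  refine (h.congr_deriv ?_).congr_of_eventuallyEq (Filter.Eventually.of_forall fun y => ?_)
  · simp only [ee]; push_cast; ring_nf
  · simp only [ee]; push_cast; ring_nf

lemma continuous_genFun (m : ℝ) (Z : ℂ) : Continuous fun x : ℝ => genFun x m Z := by
  unfold genFun; fun_prop

lemma integral_genFun {m y : ℝ} (hy : ee m * ee y = 1) {Z : ℂ} (hZ : ee m * Complex.exp Z ≠ 1) :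
    ∫ x in (0 : ℝ)..1, ee ((-(y * x) : ℝ) : ℂ) * genFun x m Z = 1 / (Z - 2 * π * I * y) := by
  have hA : Z - 2 * π * I * y ≠ 0 := by
    intro h
    apply hZ
    rw [sub_eq_zero.mp h]; exact hy
  have hden : ee m * Complex.exp Z - 1 ≠ 0 := sub_ne_zero.mpr hZ
  have hd : ∀ x ∈ Set.uIcc (0 : ℝ) 1, HasDerivAt (fun x : ℝ =>
      Complex.exp ((Z - 2 * π * I * y) * x) / ((Z - 2 * π * I * y) * (ee m * Complex.exp Z - 1)))
      (ee ((-(y * x) : ℝ) : ℂ) * genFun x m Z) x := by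
    intro x _
    have hx : HasDerivAt (fun x : ℝ => (x : ℂ)) 1 x := Complex.ofRealCLM.hasDerivAt
    refine ((hx.const_mul (Z - 2 * π * I * y)).cexp.div_const _).congr_deriv ?_
    have he : ee ((-(y * x) : ℝ) : ℂ) * Complex.exp (x * Z) =
        Complex.exp ((Z - 2 * π * I * y) * x) := by
      rw [ee, ← Complex.exp_add]; congr 1; push_cast; ring
    rw [genFun, mul_div_assoc', he]
    field_simp
  rw [intervalIntegral.integral_eq_sub_of_hasDerivAt hd]
  · have h1 : Complex.exp (Z - 2 * π * I * y) = ee m * Complex.exp Z := by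
      rw [Complex.exp_sub]
      change Complex.exp Z / ee y = _
      rw [div_eq_iff (ee_ne_zero _)]
      linear_combination -Complex.exp Z * hy
    simp only [Complex.ofReal_one, mul_one, Complex.ofReal_zero, mul_zero, Complex.exp_zero, h1]
    field_simp
  · refine Continuous.intervalIntegrable ?_ _ _
    exact (continuous_ee.comp (by fun_prop)).mul (continuous_genFun _ _)

lemma IsAppell.integral_step {m y : ℝ} (hy : ee m * ee y = 1) {p : ℕ → ℝ → ℂ} (hp : IsAppell m p)
    (j : ℕ) :
    (∫ x in (0 : ℝ)..1, ee ((-(y * x) : ℝ) : ℂ) * p j x) -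
      2 * π * I * y * ∫ x in (0 : ℝ)..1, ee ((-(y * x) : ℝ) : ℂ) * p (j + 1) x =
      if j = 0 then 1 else 0 := by
  have hcont : ∀ j, Continuous fun x : ℝ => ee ((-(y * x) : ℝ) : ℂ) * p j x := fun j =>
    (continuous_ee.comp (by fun_prop)).mul (hp.continuous j)
  have hd : ∀ x ∈ Set.uIcc (0 : ℝ) 1, HasDerivAt (fun x : ℝ => ee ((-(y * x) : ℝ) : ℂ) * p (j + 1) x)
      (ee ((-(y * x) : ℝ) : ℂ) * p j x -
        2 * π * I * y * (ee ((-(y * x) : ℝ) : ℂ) * p (j + 1) x)) x := by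
    intro x _
    have h := (hasDerivAt_ee (-y) x).fun_mul (hp.deriv_succ j x)
    simp only [neg_mul] at h
    refine h.congr_deriv ?_
    push_cast; ring
  have h := intervalIntegral.integral_eq_sub_of_hasDerivAt hd
    (Continuous.intervalIntegrable ((hcont j).sub (continuous_const.mul (hcont (j + 1)))) _ _)
  have hcont' : Continuous fun x : ℝ =>
      2 * π * I * y * (ee ((-(y * x) : ℝ) : ℂ) * p (j + 1) x) :=
    continuous_const.mul (hcont (j + 1))
  rw [intervalIntegral.integral_sub ((hcont j).intervalIntegrable _ _)
    (hcont'.intervalIntegrable _ _), intervalIntegral.integral_const_mul] at h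
  rw [h]
  have hj := hp.jump (j + 1)
  have : ee ((-(y * 1) : ℝ) : ℂ) = ee m := by
    push_cast; rw [mul_one, ee_neg]; exact (eq_inv_of_mul_eq_one_left hy).symm
  rw [this]
  simp only [mul_zero, neg_zero, Complex.ofReal_zero, ee_zero, one_mul, hj]
  simp

lemma IsAppell.integral_zero {m y : ℝ} (hy : ee m * ee y = 1) {p : ℕ → ℝ → ℂ} (hp : IsAppell m p)
    (hy0 : y ≠ 0) : ∫ x in (0 : ℝ)..1, ee ((-(y * x) : ℝ) : ℂ) * p 0 x = 0 := by
  have hd : ∀ x ∈ Set.uIcc (0 : ℝ) 1, HasDerivAt (fun x : ℝ => ee ((-(y * x) : ℝ) : ℂ) * p 0 x)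
      (- 2 * π * I * y * (ee ((-(y * x) : ℝ) : ℂ) * p 0 x)) x := by
    intro x _
    have h := (hasDerivAt_ee (-y) x).fun_mul (hp.deriv_zero x)
    simp only [neg_mul] at h
    refine h.congr_deriv ?_
    push_cast; ring
  have hcont : Continuous fun x : ℝ => ee ((-(y * x) : ℝ) : ℂ) * p 0 x :=
    (continuous_ee.comp (by fun_prop)).mul (hp.continuous 0)
  have h := intervalIntegral.integral_eq_sub_of_hasDerivAt hd
    (Continuous.intervalIntegrable (continuous_const.mul hcont) _ _)
  rw [intervalIntegral.integral_const_mul] at h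
  have hj := hp.jump 0
  have : ee ((-(y * 1) : ℝ) : ℂ) = ee m := by
    push_cast; rw [mul_one, ee_neg]; exact (eq_inv_of_mul_eq_one_left hy).symm
  rw [this] at h
  simp only [mul_zero, neg_zero, Complex.ofReal_zero, ee_zero, one_mul, hj] at h
  refine (mul_eq_zero.mp (h.trans (by simp))).resolve_left ?_
  have : (π : ℂ) ≠ 0 := by exact_mod_cast Real.pi_ne_zero
  have : (y : ℂ) ≠ 0 := by exact_mod_cast hy0
  simp [*]

lemma IsAppell.integral_of_ne {m y : ℝ} (hy : ee m * ee y = 1) {p : ℕ → ℝ → ℂ}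
    (hp : IsAppell m p) (hy0 : y ≠ 0) (j : ℕ) :
    ∫ x in (0 : ℝ)..1, ee ((-(y * x) : ℝ) : ℂ) * p j x =
      if j = 0 then 0 else -((2 * π * I * y) ^ j)⁻¹ := by
  have hA : (2 * π * I * y : ℂ) ≠ 0 := by
    have : (y : ℂ) ≠ 0 := by exact_mod_cast hy0
    exact mul_ne_zero Complex.two_pi_I_ne_zero this
  induction j with
  | zero => simpa using hp.integral_zero hy hy0
  | succ j ih =>
    have h := hp.integral_step hy j
    rw [ih] at h
    rw [if_neg (Nat.succ_ne_zero j)]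
    refine mul_left_cancel₀ hA ?_
    rcases eq_or_ne j 0 with rfl | hj
    · simp only [if_true] at h
      rw [zero_add, pow_one, mul_neg, mul_inv_cancel₀ hA]
      linear_combination -h
    · simp only [if_neg hj] at h
      rw [pow_succ', mul_inv, mul_neg, mul_inv_cancel_left₀ hA]
      linear_combination -h

lemma IsAppell.integral_of_eq {m : ℝ} (hm : ee m = 1) {p : ℕ → ℝ → ℂ}
    (hp : IsAppell m p) (j : ℕ) :
    ∫ x in (0 : ℝ)..1, ee ((-(0 * x) : ℝ) : ℂ) * p j x = if j = 0 then 1 else 0 := by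
  have h := hp.integral_step (y := 0) (by simp [hm, ee_zero]) j
  simpa using h

/-! ### One-dimensional lattice sums in closed form -/

lemma hasSum_yterm_of_integral {ν : ℝ} {f : ℝ → ℂ} (hf : ContinuousOn f (Set.Icc 0 1))
    (hper : ee ν * f 1 = f 0) {K : ℕ} (hK : 2 ≤ K) {r : ℤ → ℂ} {B : ℝ} (hr : ∀ n, ‖r n‖ ≤ B)
    (h : ∀ n : ℤ, ∫ x in (0 : ℝ)..1, ee ((-((-(ν + n)) * x) : ℝ) : ℂ) * f x =
      if ν + n = 0 then 0 else (((ν + n : ℝ) : ℂ) ^ K)⁻¹ * r n)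
    {x : ℝ} (hx : x ∈ Set.Icc (0 : ℝ) 1) :
    HasSum (fun n : ℤ => yterm K (-x) ν n * r n) (f x) := by
  set t : ℤ → ℂ := fun n => if ν + n = 0 then 0 else (((ν + n : ℝ) : ℂ) ^ K)⁻¹ * r n with ht
  have hts : Summable t := by
    refine Summable.of_norm_bounded
      ((summable_latBound (k := K) ν (δ := 0) (Or.inr ⟨le_rfl, by exact_mod_cast hK⟩)).mul_right B)
      fun n => ?_
    simp only [ht, latBound]
    split_ifs
    · simp
    · rw [norm_mul, norm_inv, norm_pow, Complex.norm_real, zpow_neg, zpow_natCast]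
      simp only [Real.norm_eq_abs, neg_zero, zero_mul, Real.exp_zero, mul_one]
      exact mul_le_mul_of_nonneg_left (hr n) (by positivity)
  have hs : Summable fun n : ℤ => t (-n) := (Equiv.neg ℤ).summable_iff.mpr hts
  have hper' : f 1 = ee ((-ν : ℝ) : ℂ) * f 0 := by
    rw [← hper, ← mul_assoc, ← ee_add]; push_cast; simp [ee_zero]
  have key := hasSum_fourier_twisted (c := -ν) (a := fun n => t (-n)) hf hper'
    (fun n => by
      have := h (-n)
      simp only [ht]
      rw [← this]
      push_cast
      simp only [neg_add, neg_neg]) hs hx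
  rw [← (Equiv.neg ℤ).hasSum_iff] at key
  convert! key using 1
  ext n
  simp only [Function.comp, Equiv.neg_apply, neg_neg, ht, yterm]
  split_ifs
  · simp
  · rw [zpow_neg, zpow_natCast]
    have : ((ν + n) * -x : ℝ) = (-ν + ((-n : ℤ) : ℝ)) * x := by push_cast; ring
    rw [this]; ring

lemma partial_fraction {a w : ℂ} (ha : a ≠ 0) (hw : w ≠ 0) (haw : a + w ≠ 0) (K : ℕ) :
    ((-w) ^ K)⁻¹ / (a + w) - ∑ j ∈ Finset.range K, ((-w) ^ (K - j))⁻¹ * (a ^ (j + 1))⁻¹ =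
      (a ^ K)⁻¹ / (a + w) := by
  induction K with
  | zero => simp
  | succ K ih =>
    rw [Finset.sum_range_succ]
    have : ∑ j ∈ Finset.range K, ((-w) ^ (K + 1 - j))⁻¹ * (a ^ (j + 1))⁻¹ =
        (-w)⁻¹ * ∑ j ∈ Finset.range K, ((-w) ^ (K - j))⁻¹ * (a ^ (j + 1))⁻¹ := by
      rw [Finset.mul_sum]
      refine Finset.sum_congr rfl fun j hj => ?_
      rw [Nat.succ_sub (Finset.mem_range.mp hj).le, pow_succ, mul_inv]; ring
    rw [this, Nat.add_sub_cancel_left, pow_one, pow_succ, mul_inv]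
    have h2 : ∑ j ∈ Finset.range K, ((-w) ^ (K - j))⁻¹ * (a ^ (j + 1))⁻¹ =
      ((-w) ^ K)⁻¹ / (a + w) - (a ^ K)⁻¹ / (a + w) := by rw [← ih]; ring
    rw [h2]
    field_simp
    ring

lemma IsAppell.hasSum_yterm {ν : ℝ} {q : ℕ → ℝ → ℂ} (hq : IsAppell ν q) {K : ℕ} (hK : 2 ≤ K)
    {x : ℝ} (hx : x ∈ Set.Icc (0 : ℝ) 1) :
    HasSum (fun n : ℤ => yterm K (-x) ν n) (-(-2 * π * I) ^ K * q K x) := by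
  have h := hasSum_yterm_of_integral (ν := ν) (f := fun x => -(-2 * π * I) ^ K * q K x)
    (r := fun _ => 1) (B := 1) (K := K) ?_ ?_ hK ?_ ?_ hx
  · simpa using h
  · exact (continuous_const.mul (hq.continuous K)).continuousOn
  · have := hq.jump K
    rw [if_neg (by omega)] at this
    linear_combination (-(-2 * π * I) ^ K : ℂ) * this
  · simp
  · intro n
    have hy : ee ν * ee ((-(ν + n) : ℝ) : ℂ) = 1 := by
      push_cast; rw [← ee_add, show (ν : ℂ) + -(ν + n) = ((-n : ℤ) : ℂ) by push_cast; ring, ee_int]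
    simp_rw [mul_left_comm _ (-(-2 * (π : ℂ) * I) ^ K)]
    rw [intervalIntegral.integral_const_mul]
    split_ifs with h0
    · rw [h0] at hy ⊢
      rw [neg_zero, hq.integral_of_eq (by simpa [ee_zero] using hy), if_neg (by omega), mul_zero]
    · rw [hq.integral_of_ne hy (neg_ne_zero.mpr h0), if_neg (by omega)]
      have h1 : ((ν + n : ℝ) : ℂ) ≠ 0 := by exact_mod_cast h0
      have h2 : (2 * π * I * ((-(ν + n) : ℝ) : ℂ)) = (-2 * π * I) * ((ν + n : ℝ) : ℂ) := by
        push_cast; ring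
      have h3 : (-2 * π * I : ℂ) ^ K ≠ 0 := pow_ne_zero _ (by simp [Real.pi_ne_zero])
      rw [h2, mul_pow _ ((ν + n : ℝ) : ℂ)]
      generalize (-2 * π * I : ℂ) ^ K = A at h3 ⊢
      field_simp

lemma ee_mul_exp_ne_one {ν : ℝ} {w : ℂ} (hw : w.im ≠ 0) :
    ee ν * Complex.exp (2 * π * I * w) ≠ 1 := by
  change ee ν * ee w ≠ 1
  rw [← ee_add, Ne, ee_eq_one_iff]
  rintro ⟨n, hn⟩
  apply hw
  have := congrArg Complex.im hn
  simpa using this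

lemma genFun_jump {m : ℝ} {Z : ℂ} (hZ : ee m * Complex.exp Z ≠ 1) :
    ee m * genFun 1 m Z - genFun 0 m Z = 1 := by
  have := sub_ne_zero.mpr hZ
  simp only [genFun]; push_cast; field_simp; simp

lemma IsAppell.hasSum_yterm_div {ν : ℝ} {q : ℕ → ℝ → ℂ} (hq : IsAppell ν q) {K : ℕ} (hK : 2 ≤ K)
    {w : ℂ} (hw : w.im ≠ 0) {x : ℝ} (hx : x ∈ Set.Icc (0 : ℝ) 1) :
    HasSum (fun n : ℤ => yterm K (-x) ν n * (((ν + n : ℝ) : ℂ) + w)⁻¹)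
      (2 * π * I * ((-w) ^ K)⁻¹ * genFun x ν (2 * π * I * w) +
        ∑ j ∈ Finset.range (K + 1), ((-w) ^ (K + 1 - j))⁻¹ * (-2 * π * I) ^ j * q j x) := by
  have hden := ee_mul_exp_ne_one (ν := ν) hw
  have hw0 : w ≠ 0 := by rintro rfl; simp at hw
  have hc1 : Continuous fun x => 2 * π * I * ((-w) ^ K)⁻¹ * genFun x ν (2 * π * I * w) :=
    continuous_const.mul (continuous_genFun _ _)
  have hc2 : ∀ j, Continuous fun x => ((-w) ^ (K + 1 - j))⁻¹ * (-2 * π * I) ^ j * q j x :=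
    fun j => continuous_const.mul (hq.continuous j)
  refine hasSum_yterm_of_integral (ν := ν) (B := |w.im|⁻¹)
    (f := fun x => 2 * π * I * ((-w) ^ K)⁻¹ * genFun x ν (2 * π * I * w) +
        ∑ j ∈ Finset.range (K + 1), ((-w) ^ (K + 1 - j))⁻¹ * (-2 * π * I) ^ j * q j x)
    ?_ ?_ hK (fun n => ?_) (fun n => ?_) hx
  · exact (hc1.add (continuous_finsetSum _ fun j _ => hc2 j)).continuousOn
  · have h1 := genFun_jump hden
    have h2 : ee ν * ∑ j ∈ Finset.range (K + 1), ((-w) ^ (K + 1 - j))⁻¹ * (-2 * π * I) ^ j * q j 1 -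
        ∑ j ∈ Finset.range (K + 1), ((-w) ^ (K + 1 - j))⁻¹ * (-2 * π * I) ^ j * q j 0 =
        ((-w) ^ K)⁻¹ * (-2 * π * I) := by
      rw [Finset.mul_sum, ← Finset.sum_sub_distrib]
      have : ∀ j ∈ Finset.range (K + 1), ee ν * (((-w) ^ (K + 1 - j))⁻¹ * (-2 * π * I) ^ j * q j 1) -
        ((-w) ^ (K + 1 - j))⁻¹ * (-2 * π * I) ^ j * q j 0 =
        if j = 1 then ((-w) ^ K)⁻¹ * (-2 * π * I) else 0 := by
        intro j _
        have hj := hq.jump j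
        split_ifs with h
        · subst h
          rw [if_pos rfl] at hj
          rw [Nat.add_sub_cancel]
          linear_combination (((-w) ^ K)⁻¹ * (-2 * π * I)) * hj
        · rw [if_neg h] at hj
          linear_combination (((-w) ^ (K + 1 - j))⁻¹ * (-2 * π * I) ^ j) * hj
      rw [Finset.sum_congr rfl this, Finset.sum_ite_eq', if_pos (by simp; omega)]
    linear_combination (2 * π * I * ((-w) ^ K)⁻¹) * h1 + h2
  · rw [norm_inv]
    refine inv_anti₀ (abs_pos.mpr hw) ?_
    simpa using Complex.abs_im_le_norm (((ν + n : ℝ) : ℂ) + w)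
  · have hy : ee ν * ee ((-(ν + n) : ℝ) : ℂ) = 1 := by
      push_cast; rw [← ee_add, show (ν : ℂ) + -(ν + n) = ((-n : ℤ) : ℂ) by push_cast; ring, ee_int]
    set y : ℝ := -(ν + n) with hydef
    have hcy : Continuous fun x : ℝ => ee ((-(y * x) : ℝ) : ℂ) := continuous_ee.comp (by fun_prop)
    have haw : ((ν + n : ℝ) : ℂ) + w ≠ 0 := by
      intro h
      apply hw
      simpa using congrArg Complex.im h
    simp_rw [mul_add, Finset.mul_sum]
    have hd1 : Continuous fun x : ℝ => ee ((-(y * x) : ℝ) : ℂ) *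
        (2 * π * I * ((-w) ^ K)⁻¹ * genFun x ν (2 * π * I * w)) := hcy.mul hc1
    have hd2 : ∀ j, Continuous fun x : ℝ => ee ((-(y * x) : ℝ) : ℂ) *
        (((-w) ^ (K + 1 - j))⁻¹ * (-2 * π * I) ^ j * q j x) := fun j => hcy.mul (hc2 j)
    rw [intervalIntegral.integral_add (hd1.intervalIntegrable _ _)
      ((continuous_finsetSum _ fun j _ => hd2 j).intervalIntegrable _ _),
      intervalIntegral.integral_finsetSum fun j _ => (hd2 j).intervalIntegrable _ _]
    simp_rw [mul_left_comm (ee _)]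
    simp_rw [intervalIntegral.integral_const_mul]
    rw [integral_genFun hy hden]
    have h2 : 2 * π * I * w - 2 * π * I * y = 2 * π * I * (((ν + n : ℝ) : ℂ) + w) := by
      rw [hydef]; push_cast; ring
    rw [h2]
    have h2pi : (2 * π * I : ℂ) ≠ 0 := Complex.two_pi_I_ne_zero
    split_ifs with h0
    · have hy0 : y = 0 := by rw [hydef, h0, neg_zero]
      rw [hy0] at hy ⊢
      have hν : ee ν = 1 := by simpa [ee_zero] using hy
      simp_rw [hq.integral_of_eq hν]
      rw [h0]
      simp only [mul_ite, mul_one, mul_zero, Finset.sum_ite_eq']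
      rw [if_pos (by simp)]
      rw [Nat.sub_zero, pow_succ, pow_zero]
      field_simp
      simp [hw0]
    · have hy0 : y ≠ 0 := neg_ne_zero.mpr h0
      simp_rw [hq.integral_of_ne hy hy0]
      have h1 : ((ν + n : ℝ) : ℂ) ≠ 0 := by exact_mod_cast h0
      rw [← div_eq_mul_inv (b := ((ν + n : ℝ) : ℂ) + w), ← partial_fraction h1 hw0 haw K,
        Finset.sum_range_succ', sub_eq_add_neg]
      simp only [if_true, mul_zero, add_zero]
      congr 1
      · field_simp
      · rw [← Finset.sum_neg_distrib]
        refine Finset.sum_congr rfl fun j _ => ?_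
        rw [if_neg (Nat.succ_ne_zero j), Nat.add_sub_add_right,
          show (2 * π * I * (y : ℂ)) = (-2 * π * I) * ((ν + n : ℝ) : ℂ) by
            rw [hydef]; push_cast; ring, mul_pow _ ((ν + n : ℝ) : ℂ)]
        have h3 : (-2 * π * I : ℂ) ^ (j + 1) ≠ 0 := pow_ne_zero _ (by simp [Real.pi_ne_zero])
        generalize (-2 * π * I : ℂ) ^ (j + 1) = A at h3 ⊢
        field_simp

/-! ### Lattice sums of generating functions -/

lemma le_norm_ee_mul_exp_sub_one {m r : ℝ} {Z : ℂ} (hr : 0 < r) (hZ : r ≤ |Z.re|) :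
    (1 - Real.exp (-r)) * max 1 (Real.exp Z.re) ≤ ‖ee m * Complex.exp Z - 1‖ := by
  have hn : ‖ee m * Complex.exp Z‖ = Real.exp Z.re := by
    rw [norm_mul, norm_ee, one_mul, Complex.norm_exp]
  rcases le_abs'.mp hZ with h | h
  · rw [max_eq_left (Real.exp_le_one_iff.mpr (by linarith)), mul_one]
    have h1 := norm_sub_norm_le (1 : ℂ) (ee m * Complex.exp Z)
    rw [hn, norm_one, norm_sub_rev] at h1
    linarith [Real.exp_le_exp.mpr h]
  · rw [max_eq_right (Real.one_le_exp_iff.mpr (by linarith))]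
    have h1 := norm_sub_norm_le (ee m * Complex.exp Z) 1
    rw [hn, norm_one] at h1
    refine le_trans ?_ h1
    have h2 : 1 ≤ Real.exp (-r) * Real.exp Z.re := by
      rw [← Real.exp_add]; exact Real.one_le_exp_iff.mpr (by linarith)
    linarith

lemma norm_genFun_le {x m r e : ℝ} {Z : ℂ} (hr : 0 < r) (hZ : r ≤ |Z.re|)
    (hneg : Z.re < 0 → e ≤ x) (hpos : 0 < Z.re → x ≤ 1 - e) :
    ‖genFun x m Z‖ ≤ (1 - Real.exp (-r))⁻¹ * Real.exp (-e * |Z.re|) := by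
  have h1 : 0 < 1 - Real.exp (-r) := by
    rw [sub_pos, Real.exp_lt_one_iff]; linarith
  have h2 := le_norm_ee_mul_exp_sub_one (m := m) hr hZ
  have h3 : 0 < max 1 (Real.exp Z.re) := lt_max_of_lt_left one_pos
  rw [genFun, norm_div, Complex.norm_exp, div_le_iff₀ (lt_of_lt_of_le (mul_pos h1 h3) h2)]
  refine le_trans ?_ (mul_le_mul_of_nonneg_left h2 (by positivity))
  have h4 : (1 - Real.exp (-r))⁻¹ * (1 - Real.exp (-r)) = 1 := inv_mul_cancel₀ h1.ne'
  rw [Complex.re_ofReal_mul]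
  rw [mul_mul_mul_comm, h4, one_mul]
  rcases lt_or_ge Z.re 0 with h | h
  · refine le_trans ?_ (mul_le_mul_of_nonneg_left (le_max_left _ _) (Real.exp_pos _).le)
    rw [mul_one, Real.exp_le_exp, abs_of_neg h]
    nlinarith [hneg h]
  · have h' : 0 < Z.re := by
      rcases h.lt_or_eq with h | h
      · exact h
      · rw [← h] at hZ; simp at hZ; linarith
    refine le_trans ?_ (mul_le_mul_of_nonneg_left (le_max_right _ _) (Real.exp_pos _).le)
    rw [← Real.exp_add, Real.exp_le_exp, abs_of_pos h']
    nlinarith [hpos h']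

lemma exists_pos_le_abs_add_int (c : ℝ) : ∃ r > 0, ∀ n : ℤ, c + n ≠ 0 → r ≤ |c + n| := by
  have h := (tendsto_abs_add_int c).eventually_ge_atTop 1
  rw [Filter.eventually_cofinite] at h
  by_cases hne : (h.toFinset.filter fun n : ℤ => c + n ≠ 0).Nonempty
  · obtain ⟨n0, hn0, hmin⟩ := Finset.exists_min_image _ (fun n : ℤ => |c + n|) hne
    rw [Finset.mem_filter] at hn0
    refine ⟨min 1 |c + n0|, lt_min one_pos (abs_pos.mpr hn0.2), fun n hn => ?_⟩
    by_cases h1 : 1 ≤ |c + n|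
    · exact (min_le_left _ _).trans h1
    · exact (min_le_right _ _).trans (hmin n (by simpa [hn] using h1))
  · refine ⟨1, one_pos, fun n hn => ?_⟩
    by_contra h1
    exact hne ⟨n, by simpa [hn] using h1⟩

/-- The general term of the lattice sum `lsum`. -/
def lterm (k : ℤ) (a m b c : ℝ) (s : ℂ) (n : ℤ) : ℂ :=
  yterm k b c n * genFun a m (s * ((c + n : ℝ) : ℂ))

/-- The lattice sum `∑ y ∈ c + ℤ, y ≠ 0` of `e(y b) y⁻ᵏ exp (a s y) / (e(m) exp (s y) - 1)`. -/
def lsum (k : ℤ) (a m b c : ℝ) (s : ℂ) : ℂ := ∑' n : ℤ, lterm k a m b c s n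

lemma exists_norm_lterm_le (c : ℝ) {s : ℂ} (hs : s.re < 0) :
    ∃ M, 0 ≤ M ∧ ∀ (k : ℤ) (a m b e : ℝ) (n : ℤ), (0 < c + n → e ≤ a) → (c + n < 0 → a ≤ 1 - e) →
      ‖lterm k a m b c s n‖ ≤ M * latBound k c (e * -s.re) n := by
  obtain ⟨r, hr, h⟩ := exists_pos_le_abs_add_int c
  have hrs : 0 < r * -s.re := mul_pos hr (by linarith)
  have h1 : 0 < 1 - Real.exp (-(r * -s.re)) := by
    rw [sub_pos, Real.exp_lt_one_iff]; linarith
  refine ⟨(1 - Real.exp (-(r * -s.re)))⁻¹, by positivity, fun k a m b e n hp hn => ?_⟩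
  by_cases h0 : c + n = 0
  · rw [lterm, yterm, if_pos h0, zero_mul, norm_zero]
    exact mul_nonneg (by positivity) (latBound_nonneg _ _ _ _)
  · have hre : (s * ((c + n : ℝ) : ℂ)).re = s.re * (c + n) := by
      rw [mul_comm, Complex.re_ofReal_mul, mul_comm]
    have habs : |(s * ((c + n : ℝ) : ℂ)).re| = -s.re * |c + n| := by
      rw [hre, abs_mul, abs_of_neg hs]
    have h2 := norm_genFun_le (x := a) (m := m) (e := e) (Z := s * ((c + n : ℝ) : ℂ)) hrs
      (by rw [habs, mul_comm]; exact mul_le_mul_of_nonneg_left (h n h0) (by linarith))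
      (fun h => hp (by rw [hre] at h; nlinarith))
      (fun h => hn (by rw [hre] at h; nlinarith))
    rw [lterm, norm_mul, ← norm_yterm_mul_exp k b c (e * -s.re) n, mul_left_comm]
    refine mul_le_mul_of_nonneg_left (h2.trans_eq ?_) (norm_nonneg _)
    rw [habs]; congr 2; ring

lemma summable_lterm {k : ℤ} {a e : ℝ} (m b c : ℝ) {s : ℂ} (hs : s.re < 0)
    (he : 0 < e ∨ 0 ≤ e ∧ 2 ≤ k) (h0 : e ≤ a) (h1 : a ≤ 1 - e) :
    Summable (lterm k a m b c s) := by
  obtain ⟨M, -, hM⟩ := exists_norm_lterm_le c hs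
  have he' : 0 < e * -s.re ∨ 0 ≤ e * -s.re ∧ 2 ≤ k :=
    he.imp (fun h => mul_pos h (by linarith)) fun h => ⟨mul_nonneg h.1 (by linarith), h.2⟩
  exact Summable.of_norm_bounded ((summable_latBound c he').mul_left M)
    fun n => hM k a m b e n (fun _ => h0) (fun _ => h1)

lemma continuous_lterm (k : ℤ) (m b c : ℝ) (s : ℂ) (n : ℤ) :
    Continuous fun a => lterm k a m b c s n :=
  continuous_const.mul (continuous_genFun _ _)

lemma continuousOn_lsum {k : ℤ} (hk : 2 ≤ k) (m b c : ℝ) {s : ℂ} (hs : s.re < 0) :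
    ContinuousOn (fun a => lsum k a m b c s) (Set.Icc 0 1) := by
  obtain ⟨M, -, hM⟩ := exists_norm_lterm_le c hs
  refine continuousOn_tsum (fun n => (continuous_lterm k m b c s n).continuousOn)
    ((summable_latBound c (Or.inr ⟨?_, hk⟩)).mul_left M)
    fun n x hx => hM k x m b 0 n (fun _ => hx.1) (fun _ => by simpa using hx.2)
  simp

lemma hasSum_integral_lterm {k : ℤ} (hk : 2 ≤ k) (m b c y : ℝ) {s : ℂ} (hs : s.re < 0) :
    HasSum (fun n => ∫ x in (0 : ℝ)..1, ee ((-(y * x) : ℝ) : ℂ) * lterm k x m b c s n)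
      (∫ x in (0 : ℝ)..1, ee ((-(y * x) : ℝ) : ℂ) * lsum k x m b c s) := by
  obtain ⟨M, -, hM⟩ := exists_norm_lterm_le c hs
  have hcy : Continuous fun x : ℝ => ee ((-(y * x) : ℝ) : ℂ) := continuous_ee.comp (by fun_prop)
  have hsum : Summable fun n => M * latBound k c (0 * -s.re) n :=
    (summable_latBound c (Or.inr ⟨by simp, hk⟩)).mul_left M
  refine intervalIntegral.hasSum_integral_of_dominated_convergence
    (fun n _ => M * latBound k c (0 * -s.re) n)
    (fun n => (hcy.mul (continuous_lterm k m b c s n)).aestronglyMeasurable)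
    (fun n => .of_forall fun x hx => ?_) (.of_forall fun x _ => hsum) (by simp)
    (.of_forall fun x hx => HasSum.mul_left _ (Summable.hasSum ?_))
  · rw [Set.uIoc_of_le zero_le_one] at hx
    rw [norm_mul, norm_ee, one_mul]
    exact hM k x m b 0 n (fun _ => hx.1.le) (fun _ => by simpa using hx.2)
  · rw [Set.uIoc_of_le zero_le_one] at hx
    exact summable_lterm m b c hs (Or.inr ⟨le_rfl, hk⟩) hx.1.le (by simpa using hx.2)

lemma ee_mul_exp_ne_one_of_re {m : ℝ} {Z : ℂ} (hZ : Z.re ≠ 0) : ee m * Complex.exp Z ≠ 1 := by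
  intro h
  have := congrArg norm h
  rw [norm_mul, norm_ee, one_mul, Complex.norm_exp, norm_one, Real.exp_eq_one_iff] at this
  exact hZ this

lemma re_mul_ofReal_ne_zero {s : ℂ} (hs : s.re < 0) {y : ℝ} (hy : y ≠ 0) :
    (s * (y : ℂ)).re ≠ 0 := by
  rw [mul_comm, Complex.re_ofReal_mul]
  exact mul_ne_zero hy hs.ne

lemma lterm_jump {c m : ℝ} {s : ℂ} (hs : s.re < 0) (k : ℤ) (b : ℝ) (n : ℤ) :
    ee m * lterm k 1 m b c s n - lterm k 0 m b c s n = yterm k b c n := by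
  by_cases h : c + n = 0
  · simp [lterm, yterm, h]
  · have := genFun_jump (m := m) (Z := s * ((c + n : ℝ) : ℂ))
      (ee_mul_exp_ne_one_of_re (re_mul_ofReal_ne_zero hs h))
    rw [lterm, lterm]; linear_combination yterm k b c n * this

/-- The polynomial part of the transformation formula. -/
def polyPart (k : ℤ) (p q : ℕ → ℂ) (u : ℂ) : ℂ :=
  (-2 * π * I) ^ k * ∑ j ∈ Finset.range (k + 2).toNat,
    (-1) ^ j * p j * q ((k + 1).toNat - j) * u ^ (k - j)

lemma polyPart_nat (K : ℕ) (p q : ℕ → ℂ) (u : ℂ) :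
    polyPart K p q u = (-2 * π * I) ^ K * ∑ j ∈ Finset.range (K + 2),
      (-1) ^ j * p j * q (K + 1 - j) * u ^ ((K : ℤ) - j) := by
  rw [polyPart, zpow_natCast, show ((K : ℤ) + 2).toNat = K + 2 by omega,
    show ((K : ℤ) + 1).toNat = K + 1 by omega]

lemma two_pi_I_neg_ne_zero : (-2 * π * I : ℂ) ≠ 0 := by simp [Real.pi_ne_zero]

lemma integral_lterm_dual {k : ℤ} {m y b c : ℝ} (hy : ee m * ee y = 1) {u : ℂ} (hu : u ≠ 0)
    (hs : (-(-2 * π * I) / u).re < 0) (n : ℤ) :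
    ∫ x in (0 : ℝ)..1, ee ((-(y * x) : ℝ) : ℂ) * lterm k x m b c (-(-2 * π * I) / u) n =
      -(u / (-2 * π * I)) * (yterm k b c n * (((c + n : ℝ) : ℂ) + -(u * y))⁻¹) := by
  simp_rw [lterm, mul_left_comm (ee _)]
  rw [intervalIntegral.integral_const_mul]
  by_cases h : c + n = 0
  · simp [yterm, h]
  · rw [integral_genFun hy (ee_mul_exp_ne_one_of_re (re_mul_ofReal_ne_zero hs h))]
    have h2 := two_pi_I_neg_ne_zero
    have : -(-2 * π * I) / u * ((c + n : ℝ) : ℂ) - 2 * π * I * y =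
      -(-2 * π * I) / u * (((c + n : ℝ) : ℂ) + -(u * y)) := by field_simp; ring
    rw [this, one_div, mul_inv]
    generalize (-2 * π * I : ℂ) = A at *
    have : (-A / u)⁻¹ = -(u / A) := by field_simp
    rw [this]; ring

lemma lsum_reciprocity_nat {μ ν : ℝ} {p q : ℕ → ℝ → ℂ} (hp : IsAppell μ p) (hq : IsAppell ν q)
    {K : ℕ} (hK : 2 ≤ K) {u : ℂ} (hu : u ≠ 0) (hs : (-2 * π * I * u).re < 0)
    (hs' : (-(-2 * π * I) / u).re < 0) {α β : ℝ} (hα : α ∈ Set.Icc (0 : ℝ) 1)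
    (hβ : β ∈ Set.Icc (0 : ℝ) 1) :
    lsum K β ν α (-μ) (-2 * π * I * u) + polyPart K (fun j => p j α) (fun j => q j β) u =
      u ^ ((K : ℤ) - 1) * lsum K α μ (-β) ν (-(-2 * π * I) / u) := by
  set P : ℝ → ℂ := fun x => polyPart K (fun j => p j x) (fun j => q j β) u with hP
  set L : ℝ → ℂ := fun x => lsum K x μ (-β) ν (-(-2 * π * I) / u) with hL
  have hK' : (2 : ℤ) ≤ K := by exact_mod_cast hK
  have hPc : Continuous P := by
    simp only [hP, polyPart]
    refine continuous_const.mul (continuous_finsetSum _ fun j _ => ?_)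
    exact ((continuous_const.mul (hp.continuous j)).mul continuous_const).mul continuous_const
  have hLc : ContinuousOn L (Set.Icc 0 1) := continuousOn_lsum hK' _ _ _ hs'
  have huim : u.im < 0 := by
    have : (-2 * π * I * u).re = 2 * π * u.im := by simp [Complex.mul_re]
    rw [this] at hs
    nlinarith [Real.pi_pos]
  set t : ℤ → ℂ := fun n => lterm K β ν 0 (-μ) (-2 * π * I * u) n with ht
  have hts : Summable t := summable_lterm _ _ _ hs (Or.inr ⟨le_rfl, hK'⟩) hβ.1 (by simpa using hβ.2)
  have key := hasSum_fourier_twisted (c := -μ) (f := fun x => u ^ ((K : ℤ) - 1) * L x - P x)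
    (a := t) ((continuousOn_const.mul hLc).sub hPc.continuousOn) ?_ ?_ hts hα
  · have h2 : lsum K β ν α (-μ) (-2 * π * I * u) = u ^ ((K : ℤ) - 1) * L α - P α := by
      rw [← key.tsum_eq]
      refine tsum_congr fun n => ?_
      simp only [ht, lterm, yterm]
      split_ifs
      · simp
      · simp only [mul_zero, Complex.ofReal_zero, ee_zero]; ring
    rw [h2]; ring
  · have h1 : ee μ * L 1 - L 0 = -(-2 * π * I) ^ K * q K β := by
      simp only [hL, lsum]
      have e : ∀ a ∈ Set.Icc (0 : ℝ) 1, Summable (lterm K a μ (-β) ν (-(-2 * π * I) / u)) :=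
        fun a ha => summable_lterm _ _ _ hs' (Or.inr ⟨le_rfl, hK'⟩) ha.1 (by simpa using ha.2)
      rw [← tsum_mul_left, ← ((e 1 (by simp)).mul_left _).tsum_sub (e 0 (by simp)),
        ← (hq.hasSum_yterm hK hβ).tsum_eq]
      exact tsum_congr fun n => lterm_jump hs' _ _ _
    have h2 : ee μ * P 1 - P 0 = (-2 * π * I) ^ K * (-1 * q K β * u ^ ((K : ℤ) - 1)) := by
      simp only [hP, polyPart_nat]
      rw [mul_left_comm, ← mul_sub, Finset.mul_sum, ← Finset.sum_sub_distrib]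
      congr 1
      rw [Finset.sum_eq_single 1]
      · have := hp.jump 1
        rw [if_pos rfl] at this
        simp only [pow_one, Nat.add_sub_cancel, Nat.cast_one]
        linear_combination (-1 * q K β * u ^ ((K : ℤ) - 1)) * this
      · intro j _ hj
        have := hp.jump j
        rw [if_neg hj] at this
        linear_combination ((-1) ^ j * q (K + 1 - j) β * u ^ ((K : ℤ) - j)) * this
      · simp
    have h3 : ee ((-μ : ℝ) : ℂ) * ee μ = 1 := by
      rw [← ee_add]; push_cast; simp [ee_zero]
    linear_combination (ee ((-μ : ℝ) : ℂ)) * (u ^ ((K : ℤ) - 1) * h1 - h2) -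
      (u ^ ((K : ℤ) - 1) * L 1 - P 1) * h3
  · intro n
    set y : ℝ := -μ + n with hydef
    have hy : ee μ * ee y = 1 := by
      rw [← ee_add, hydef, show (μ : ℂ) + ((-μ + n : ℝ) : ℂ) = (n : ℂ) by push_cast; ring, ee_int]
    have hcy : Continuous fun x : ℝ => ee ((-(y * x) : ℝ) : ℂ) := continuous_ee.comp (by fun_prop)
    have hPint : ∫ x in (0 : ℝ)..1, ee ((-(y * x) : ℝ) : ℂ) * P x =
        (-2 * π * I) ^ K * ∑ j ∈ Finset.range (K + 2),
          (-1) ^ j * (∫ x in (0 : ℝ)..1, ee ((-(y * x) : ℝ) : ℂ) * p j x) * q (K + 1 - j) β *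
            u ^ ((K : ℤ) - j) := by
      simp only [hP, polyPart_nat]
      simp_rw [mul_left_comm _ ((-2 * (π : ℂ) * I) ^ K)]
      rw [intervalIntegral.integral_const_mul]
      simp_rw [Finset.mul_sum (Finset.range (K + 2)) _ (ee _)]
      rw [intervalIntegral.integral_finsetSum]
      · congr 1
        refine Finset.sum_congr rfl fun j _ => ?_
        have : ∀ x : ℝ, ee ((-(y * x) : ℝ) : ℂ) *
            ((-1) ^ j * p j x * q (K + 1 - j) β * u ^ ((K : ℤ) - j)) =
            (-1) ^ j * q (K + 1 - j) β * u ^ ((K : ℤ) - j) * (ee ((-(y * x) : ℝ) : ℂ) * p j x) :=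
          fun x => by ring
        simp_rw [this]
        rw [intervalIntegral.integral_const_mul]; ring
      · intro j _
        refine Continuous.intervalIntegrable ?_ _ _
        exact hcy.mul (((continuous_const.mul (hp.continuous j)).mul continuous_const).mul
          continuous_const)
    have hLint : ∫ x in (0 : ℝ)..1, ee ((-(y * x) : ℝ) : ℂ) * L x =
        -(u / (-2 * π * I)) *
          ∑' n : ℤ, yterm K (-β) ν n * (((ν + n : ℝ) : ℂ) + -(u * y))⁻¹ := by
      simp only [hL]
      rw [← (hasSum_integral_lterm hK' μ (-β) ν y hs').tsum_eq, ← tsum_mul_left]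
      exact tsum_congr fun n' => integral_lterm_dual hy hu hs' n'
    have hsub : ∫ x in (0 : ℝ)..1, ee ((-(y * x) : ℝ) : ℂ) * (u ^ ((K : ℤ) - 1) * L x - P x) =
        u ^ ((K : ℤ) - 1) * (∫ x in (0 : ℝ)..1, ee ((-(y * x) : ℝ) : ℂ) * L x) -
          ∫ x in (0 : ℝ)..1, ee ((-(y * x) : ℝ) : ℂ) * P x := by
      simp_rw [mul_sub, mul_left_comm (ee _) (u ^ ((K : ℤ) - 1))]
      rw [intervalIntegral.integral_sub, intervalIntegral.integral_const_mul]
      · refine ContinuousOn.intervalIntegrable ?_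
        rw [Set.uIcc_of_le zero_le_one]
        exact continuousOn_const.mul (hcy.continuousOn.mul hLc)
      · exact Continuous.intervalIntegrable (hcy.mul hPc) _ _
    rw [hsub, hPint, hLint]
    have h2 := two_pi_I_neg_ne_zero
    by_cases hy0 : y = 0
    · rw [hy0] at hy ⊢
      have hμ : ee μ = 1 := by simpa [ee_zero] using hy
      simp_rw [hp.integral_of_eq hμ]
      have h3 : t n = 0 := by
        simp only [ht, lterm, yterm]
        rw [if_pos (hydef ▸ hy0), zero_mul]
      have h4 : ∀ n : ℤ, yterm K (-β) ν n * (((ν + n : ℝ) : ℂ) + -(u * (0 : ℝ)))⁻¹ =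
          yterm ((K + 1 : ℕ) : ℤ) (-β) ν n := by
        intro n
        simp only [Complex.ofReal_zero, mul_zero, neg_zero, add_zero, yterm]
        split_ifs with h
        · simp
        · have : ((ν + n : ℝ) : ℂ) ≠ 0 := by exact_mod_cast h
          rw [mul_assoc, ← zpow_sub_one₀ this]
          congr 2; push_cast; ring
      rw [tsum_congr h4, (hq.hasSum_yterm (by omega : 2 ≤ K + 1) hβ).tsum_eq, h3,
        Finset.sum_eq_single 0]
      · simp only [if_true, pow_zero, Nat.sub_zero, Nat.cast_zero, sub_zero]
        rw [zpow_sub_one₀ hu, pow_succ]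
        generalize (-2 * π * I : ℂ) = A at *
        field_simp
        ring
      · intro j _ hj
        rw [if_neg hj]; ring
      · simp
    · simp_rw [hp.integral_of_ne hy hy0]
      have hy0' : (y : ℂ) ≠ 0 := by exact_mod_cast hy0
      have hw : (-(u * (y : ℂ))).im ≠ 0 := by
        rw [Complex.neg_im, mul_comm, Complex.im_ofReal_mul, neg_ne_zero]
        exact mul_ne_zero hy0 huim.ne
      have h3 : t n = ((y : ℂ) ^ K)⁻¹ * genFun β ν (-2 * π * I * u * y) := by
        simp only [ht, lterm, yterm]
        rw [if_neg (hydef ▸ hy0)]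
        simp [ee_zero, hydef]
      have h4 : (2 * π * I * -(u * y) : ℂ) = -2 * π * I * u * y := by ring
      have h5 : (2 * π * I * (y : ℂ)) = -((-2 * π * I) * y) := by ring
      rw [(hq.hasSum_yterm_div hK hw hβ).tsum_eq, h3, h4, h5,
        show (2 * π * I : ℂ) = - (-2 * π * I) by ring]
      generalize (-2 * π * I : ℂ) = A at *
      generalize (y : ℂ) = y at *
      have hsum : A ^ K * ∑ j ∈ Finset.range (K + 2),
          ((-1) ^ j * if j = 0 then 0 else -((-(A * y)) ^ j)⁻¹) * q (K + 1 - j) β *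
            u ^ ((K : ℤ) - j) = -(u ^ ((K : ℤ) - 1) * (u / A)) *
          ∑ j ∈ Finset.range (K + 1), ((- -(u * y)) ^ (K + 1 - j))⁻¹ * A ^ j * q j β := by
        rw [Finset.sum_range_succ' _ (K + 1), if_pos rfl, ← Finset.sum_range_reflect
          (fun j => ((- -(u * y)) ^ (K + 1 - j))⁻¹ * A ^ j * q j β) (K + 1)]
        simp only [if_neg (Nat.succ_ne_zero _), mul_zero, zero_mul, add_zero]
        rw [Finset.mul_sum, Finset.mul_sum]
        refine Finset.sum_congr rfl fun j hj => ?_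
        obtain ⟨i, hi⟩ : ∃ i, K = i + j := ⟨K - j, by have := Finset.mem_range.mp hj; omega⟩
        have e1 : K + 1 - (j + 1) = i := by omega
        have e2 : K + 1 - 1 - j = i := by omega
        have e3 : K + 1 - i = j + 1 := by omega
        have e4 : (K : ℤ) - ((j + 1 : ℕ) : ℤ) = i - 1 := by rw [hi]; push_cast; ring
        have e5 : u ^ ((K : ℤ) - 1) = u ^ ((i : ℤ) - 1) * u ^ j := by
          rw [← zpow_natCast u j, ← zpow_add₀ hu, hi]; congr 1; push_cast; ring
        rw [e1, e2, e3, e4, e5, hi, pow_add A i j, neg_neg, neg_pow (A * y), mul_pow, mul_pow,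
          pow_succ A j, pow_succ u j]
        have hm : ((-1 : ℂ) ^ (j + 1)) ≠ 0 := pow_ne_zero _ (by norm_num)
        generalize (-1 : ℂ) ^ (j + 1) = m at hm ⊢
        generalize u ^ ((i : ℤ) - 1) = v
        field_simp
      rw [hsum, neg_neg (u * y), mul_pow, zpow_sub_one₀ hu, zpow_natCast]
      field_simp
      ring

lemma yterm_sub_one (k : ℤ) (b c : ℝ) (n : ℤ) :
    yterm (k - 1) b c n = ((c + n : ℝ) : ℂ) * yterm k b c n := by
  simp only [yterm]
  split_ifs with h
  · simp
  · have : ((c + n : ℝ) : ℂ) ≠ 0 := by exact_mod_cast h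
    rw [neg_sub, sub_eq_add_neg, zpow_add₀ this, zpow_one]; ring

lemma hasDerivAt_yterm (k : ℤ) (b c : ℝ) (n : ℤ) :
    HasDerivAt (fun b => yterm k b c n) (2 * π * I * yterm (k - 1) b c n) b := by
  rw [yterm_sub_one]
  simp only [yterm]
  split_ifs with h
  · simpa using hasDerivAt_const b (0 : ℂ)
  · convert! (hasDerivAt_ee (c + n) b).mul_const _ using 1
    ring

lemma hasDerivAt_genFun (m : ℝ) (Z : ℂ) (x : ℝ) :
    HasDerivAt (fun x => genFun x m Z) (Z * genFun x m Z) x := by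
  have h1 : HasDerivAt (fun x : ℝ => (x : ℂ) * Z) (1 * Z) x :=
    (Complex.ofRealCLM.hasDerivAt (x := x)).mul_const Z
  convert! h1.cexp.div_const (ee m * Complex.exp Z - 1) using 1
  simp only [genFun]; ring

lemma hasDerivAt_lsum_phase {k : ℤ} {a : ℝ} (m b c : ℝ) {s : ℂ} (hs : s.re < 0)
    (ha : a ∈ Set.Ioo (0 : ℝ) 1) :
    HasDerivAt (fun b => lsum k a m b c s) (2 * π * I * lsum (k - 1) a m b c s) b := by
  have he : 0 < min a (1 - a) := lt_min ha.1 (by linarith [ha.2])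
  have hsum : ∀ k b, Summable (lterm k a m b c s) := fun k b =>
    summable_lterm m b c hs (Or.inl he) (min_le_left _ _) (by linarith [min_le_right a (1 - a)])
  have hd : ∀ (n : ℤ) (b : ℝ), HasDerivAt (fun b => lterm k a m b c s n)
      (2 * π * I * lterm (k - 1) a m b c s n) b := fun n b => by
    convert! (hasDerivAt_yterm k b c n).mul_const (genFun a m (s * ((c + n : ℝ) : ℂ))) using 1
    rw [lterm]; ring
  have := hasDerivAt_tsum_of_isPreconnected
    (u := fun n => ‖(2 * π * I : ℂ)‖ * ‖lterm (k - 1) a m b c s n‖) ((hsum _ _).norm.mul_left _)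
    isOpen_univ isPreconnected_univ (fun n b _ => hd n b)
    (fun n b' _ => by
      rw [norm_mul, lterm, lterm, norm_mul (yterm _ _ _ _), norm_mul (yterm _ _ _ _), norm_yterm,
        norm_yterm])
    (Set.mem_univ b) (hsum k b) (Set.mem_univ b)
  rwa [tsum_mul_left] at this

lemma hasDerivAt_lsum {k : ℤ} {a : ℝ} (m b c : ℝ) {s : ℂ} (hs : s.re < 0)
    (ha : a ∈ Set.Ioo (0 : ℝ) 1) :
    HasDerivAt (fun a => lsum k a m b c s) (s * lsum (k - 1) a m b c s) a := by
  obtain ⟨M, -, hM⟩ := exists_norm_lterm_le c hs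
  set e := min a (1 - a) / 2 with he
  have he0 : 0 < e := half_pos (lt_min ha.1 (by linarith [ha.2]))
  have hae : a ∈ Set.Ioo e (1 - e) := by
    have h1 := min_le_left a (1 - a)
    have h2 := min_le_right a (1 - a)
    constructor <;> linarith
  have hd : ∀ (n : ℤ) (a : ℝ), HasDerivAt (fun a => lterm k a m b c s n)
      (s * lterm (k - 1) a m b c s n) a := fun n a => by
    convert! (hasDerivAt_genFun m (s * ((c + n : ℝ) : ℂ)) a).const_mul (yterm k b c n) using 1
    rw [lterm, yterm_sub_one]; ring
  have := hasDerivAt_tsum_of_isPreconnected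
    (u := fun n => ‖s‖ * (M * latBound (k - 1) c (e * -s.re) n))
    (((summable_latBound c (Or.inl (mul_pos he0 (by linarith)))).mul_left _).mul_left _)
    isOpen_Ioo isPreconnected_Ioo (fun n a _ => hd n a)
    (fun n a' ha' => by
      rw [norm_mul]
      exact mul_le_mul_of_nonneg_left (hM _ _ _ _ _ _ (fun _ => ha'.1.le) (fun _ => ha'.2.le))
        (norm_nonneg _))
    hae (summable_lterm m b c hs (Or.inl he0) hae.1.le hae.2.le) hae
  rwa [tsum_mul_left] at this

lemma IsAppell.hasDerivAt_polyPart {μ : ℝ} {p : ℕ → ℝ → ℂ} (hp : IsAppell μ p) (k : ℤ)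
    (q : ℕ → ℂ) {u : ℂ} (x : ℝ) :
    HasDerivAt (fun x => polyPart k (fun j => p j x) q u)
      (2 * π * I * polyPart (k - 1) (fun j => p j x) q u) x := by
  simp only [polyPart]
  obtain hk | ⟨K, rfl⟩ : k + 2 ≤ 0 ∨ ∃ K : ℕ, k = (K : ℤ) - 1 := by
    rcases le_or_gt (k + 2) 0 with h | h
    · exact Or.inl h
    · exact Or.inr ⟨(k + 1).toNat, by omega⟩
  · rw [Int.toNat_of_nonpos hk, Int.toNat_of_nonpos (by omega : k - 1 + 2 ≤ 0)]
    simpa using hasDerivAt_const x (0 : ℂ)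
  · have h2 := two_pi_I_neg_ne_zero
    rw [show ((K : ℤ) - 1 + 2).toNat = K + 1 by omega, show ((K : ℤ) - 1 - 1 + 2).toNat = K by omega,
      show ((K : ℤ) - 1 + 1).toNat = K by omega, show ((K : ℤ) - 1 - 1 + 1).toNat = K - 1 by omega,
      zpow_sub_one₀ h2 ((K : ℤ) - 1)]
    simp_rw [Finset.sum_range_succ' _ K]
    have hd : HasDerivAt (fun x => ∑ j ∈ Finset.range K, (-1) ^ (j + 1) * p (j + 1) x *
        q (K - (j + 1)) * u ^ ((K : ℤ) - 1 - ((j + 1 : ℕ) : ℤ)) +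
        (-1) ^ 0 * p 0 x * q (K - 0) * u ^ ((K : ℤ) - 1 - ((0 : ℕ) : ℤ)))
        (∑ j ∈ Finset.range K, (-1) ^ (j + 1) * p j x *
        q (K - (j + 1)) * u ^ ((K : ℤ) - 1 - ((j + 1 : ℕ) : ℤ)) +
        (-1) ^ 0 * 0 * q (K - 0) * u ^ ((K : ℤ) - 1 - ((0 : ℕ) : ℤ))) x :=
      (HasDerivAt.fun_sum fun j _ => (((hp.deriv_succ j x).const_mul _).mul_const _).mul_const _).add
        ((((hp.deriv_zero x).const_mul _).mul_const _).mul_const _)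
    convert! hd.const_mul _ using 1
    rw [mul_zero, zero_mul, zero_mul, add_zero]
    have : ∑ j ∈ Finset.range K, (-1) ^ (j + 1) * p j x *
        q (K - (j + 1)) * u ^ ((K : ℤ) - 1 - ((j + 1 : ℕ) : ℤ)) = - ∑ j ∈ Finset.range K,
          (-1) ^ j * p j x * q (K - 1 - j) * u ^ ((K : ℤ) - 1 - 1 - j) := by
      rw [← Finset.sum_neg_distrib]
      refine Finset.sum_congr rfl fun j _ => ?_
      rw [show K - (j + 1) = K - 1 - j by omega,
        show (K : ℤ) - 1 - ((j + 1 : ℕ) : ℤ) = (K : ℤ) - 1 - 1 - j by push_cast; ring]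
      ring
    rw [this]
    have h3 : (2 * π * I : ℂ) = -(-2 * π * I) := by ring
    rw [h3]
    generalize (-2 * π * I : ℂ) = A at *
    field_simp

lemma lsum_reciprocity {μ ν : ℝ} {p q : ℕ → ℝ → ℂ} (hp : IsAppell μ p) (hq : IsAppell ν q)
    (k : ℤ) {u : ℂ} (hu : u ≠ 0) (hs : (-2 * π * I * u).re < 0)
    (hs' : (-(-2 * π * I) / u).re < 0) {α β : ℝ} (hα : α ∈ Set.Ioo (0 : ℝ) 1)
    (hβ : β ∈ Set.Ioo (0 : ℝ) 1) :
    lsum k β ν α (-μ) (-2 * π * I * u) + polyPart k (fun j => p j α) (fun j => q j β) u =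
      u ^ (k - 1) * lsum k α μ (-β) ν (-(-2 * π * I) / u) := by
  rcases le_total 2 k with hk | hk
  · lift k to ℕ using by omega
    exact lsum_reciprocity_nat hp hq (by exact_mod_cast hk) hu hs hs' (Set.Ioo_subset_Icc_self hα)
      (Set.Ioo_subset_Icc_self hβ)
  · induction k, hk using Int.leInductionDown generalizing α with
    | base =>
      exact lsum_reciprocity_nat (K := 2) hp hq le_rfl hu hs hs' (Set.Ioo_subset_Icc_self hα)
        (Set.Ioo_subset_Icc_self hβ)
    | pred k _ ih =>
      have hl := (hasDerivAt_lsum_phase (k := k) ν α (-μ) hs hβ).add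
        (hp.hasDerivAt_polyPart k (fun j => q j β) (u := u) α)
      have hr := (hasDerivAt_lsum (k := k) μ (-β) ν hs' hα).const_mul (u ^ (k - 1))
      have heq := hl.unique (hr.congr_of_eventuallyEq
        ((isOpen_Ioo.eventually_mem hα).mono fun x hx => ih hx))
      have h2 := two_pi_I_neg_ne_zero
      have h3 : (2 * π * I : ℂ) = -(-2 * π * I) := by ring
      rw [h3, ← mul_add] at heq
      generalize (-2 * π * I : ℂ) = A at *
      apply mul_left_cancel₀ (neg_ne_zero.mpr h2)
      rw [heq, zpow_sub_one₀ hu (k - 1)]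
      field_simp

/-! ### The double series as lattice sums -/

lemma fracP_eq (x : ℝ) : fracP x = x + (1 + ⌊-x⌋ : ℤ) := by
  rw [fracP, Int.fract]; push_cast; ring

lemma fracP_pos (x : ℝ) : 0 < fracP x := by
  rw [fracP]; linarith [Int.fract_lt_one (-x)]

lemma exists_posEquiv (γ : ℝ) :
    ∃ e : ℕ ≃ {k : ℤ // 0 < γ + (k : ℝ)}, ∀ n, γ + ((e n).1 : ℝ) = fracP γ + n := by
  have hmem : ∀ k : ℤ, 0 < γ + (k : ℝ) ↔ 1 + ⌊-γ⌋ ≤ k := fun k => by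
    rw [add_comm 1, Int.add_one_le_iff, Int.floor_lt]
    constructor <;> intro h <;> linarith
  refine ⟨⟨fun n => ⟨1 + ⌊-γ⌋ + n, (hmem _).mpr (by omega)⟩, fun k => (k.1 - (1 + ⌊-γ⌋)).toNat,
    fun n => by simp, fun k => ?_⟩, fun n => ?_⟩
  · have := (hmem k.1).mp k.2
    ext
    simp only
    omega
  · rw [fracP_eq]
    simp only [Equiv.coe_fn_mk]
    push_cast; ring

lemma hasSum_geometric_ee {x m : ℝ} {Z : ℂ} (hZ : Z.re < 0) :
    HasSum (fun n : ℕ => ee (((x + n) * m : ℝ) : ℂ) * Complex.exp (((x + n : ℝ) : ℂ) * Z))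
      (-(ee ((x * m : ℝ) : ℂ) * genFun x m Z)) := by
  have h1 : ‖ee m * Complex.exp Z‖ < 1 := by
    rw [norm_mul, norm_ee, one_mul, Complex.norm_exp]; exact Real.exp_lt_one_iff.mpr hZ
  convert! (hasSum_geometric_of_norm_lt_one h1).mul_left
    (ee ((x * m : ℝ) : ℂ) * Complex.exp ((x : ℂ) * Z)) using 1
  · ext n
    rw [mul_pow, ← Complex.exp_nat_mul, mul_mul_mul_comm, ← Complex.exp_add]
    congr 1
    · simp only [ee, ← Complex.exp_nat_mul, ← Complex.exp_add]
      congr 1; push_cast; ring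
    · congr 1; push_cast; ring
  · rw [genFun, ← neg_sub 1 (ee (m : ℂ) * _), div_neg, mul_neg, neg_neg, mul_div_assoc']
    rfl

lemma summable_double (k : ℤ) (γ c κ lam : ℝ) {s : ℂ} (hs : s.re < 0) :
    Summable fun z : {i : ℤ // 0 < γ + (i : ℝ)} × {l : ℤ // 0 < c + (l : ℝ)} =>
      ee (((γ + z.1.1) * κ : ℝ) : ℂ) * yterm k lam c z.2.1 *
        Complex.exp (s * ((γ + z.1.1 : ℝ) : ℂ) * ((c + z.2.1 : ℝ) : ℂ)) := by
  have hx := fracP_pos γ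
  have hy := fracP_pos c
  have hmin : ∀ γ : ℝ, ∀ i : {i : ℤ // 0 < γ + (i : ℝ)}, fracP γ ≤ γ + i.1 := fun γ i => by
    obtain ⟨e, he⟩ := exists_posEquiv γ
    obtain ⟨n, rfl⟩ := e.surjective i
    rw [he]; linarith [(Nat.cast_nonneg n : (0 : ℝ) ≤ n)]
  have h1 : Summable fun i : {i : ℤ // 0 < γ + (i : ℝ)} =>
      latBound 0 γ (fracP c * -s.re / 2) i.1 :=
    (summable_latBound γ (Or.inl (by have := mul_pos hy (neg_pos.mpr hs); linarith))).subtype _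
  have h2 : Summable fun i : {i : ℤ // 0 < c + (i : ℝ)} =>
      latBound k c (fracP γ * -s.re / 2) i.1 :=
    (summable_latBound c (Or.inl (by have := mul_pos hx (neg_pos.mpr hs); linarith))).subtype _
  refine Summable.of_norm_bounded
    (h1.mul_of_nonneg h2 (fun _ => latBound_nonneg _ _ _ _) (fun _ => latBound_nonneg _ _ _ _))
    fun z => ?_
  obtain ⟨i, l⟩ := z
  have hi := hmin γ i
  have hl := hmin c l
  rw [norm_mul, norm_mul, norm_ee, one_mul, norm_yterm, Complex.norm_exp]
  simp only [latBound]
  rw [if_neg i.2.ne', if_neg l.2.ne', if_neg l.2.ne', abs_of_pos i.2, abs_of_pos l.2]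
  simp only [neg_zero, zero_mul, Real.exp_zero, mul_one, zpow_zero, one_mul]
  rw [mul_left_comm]
  refine mul_le_mul_of_nonneg_left ?_ (zpow_nonneg l.2.le _)
  rw [← Real.exp_add, Real.exp_le_exp, mul_assoc, ← Complex.ofReal_mul, mul_comm,
    Complex.re_ofReal_mul]
  have e1 := mul_le_mul_of_nonneg_right hi l.2.le
  have e2 := mul_le_mul_of_nonneg_left hl i.2.le
  have e3 : 0 ≤ -s.re := by linarith
  nlinarith [mul_le_mul_of_nonneg_right e1 e3, mul_le_mul_of_nonneg_right e2 e3]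

lemma scal_eq_tsum (k : ℤ) (γ c κ lam : ℝ) {t : ℂ} (ht : (-2 * π * t).re < 0) :
    Scal k γ c κ lam t = -∑' l : {l : ℤ // 0 < c + (l : ℝ)},
      ee ((fracP γ * κ : ℝ) : ℂ) * lterm k (fracP γ) κ lam c (-2 * π * t) l.1 := by
  have hsum := summable_double k γ c κ lam ht
  set F : {i : ℤ // 0 < γ + (i : ℝ)} → {l : ℤ // 0 < c + (l : ℝ)} → ℂ := fun i l =>
    ee (((γ + i.1) * κ : ℝ) : ℂ) * yterm k lam c l.1 *
      Complex.exp (-2 * π * t * ((γ + i.1 : ℝ) : ℂ) * ((c + l.1 : ℝ) : ℂ)) with hF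
  have h1 : Scal k γ c κ lam t = ∑' i, ∑' l, F i l := by
    rw [Scal]
    refine tsum_congr fun i => tsum_congr fun l => ?_
    simp only [hF]
    rw [yterm, if_neg l.2.ne', ← Complex.cpow_intCast, Complex.ofReal_add (_ * _), ee_add,
      Int.cast_neg, mul_assoc (ee _)]
  have h2 : ∑' i, ∑' l, F i l = ∑' l, ∑' i, F i l :=
    (Summable.tsum_comm (f := fun i l => F i l) hsum).symm
  rw [h1, h2, ← tsum_neg]
  refine tsum_congr fun l => ?_
  simp only [hF]
  obtain ⟨e, he⟩ := exists_posEquiv γ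
  rw [← e.tsum_eq]
  have hre : (-2 * π * t * ((c + l.1 : ℝ) : ℂ)).re < 0 := by
    rw [mul_comm, Complex.re_ofReal_mul]
    exact mul_neg_of_pos_of_neg l.2 ht
  have := (hasSum_geometric_ee (x := fracP γ) (m := κ) hre).mul_left (yterm k lam c l.1)
  rw [lterm, mul_left_comm, ← mul_neg, ← this.tsum_eq]
  refine tsum_congr fun n => ?_
  rw [he]
  have : -2 * π * t * ((fracP γ + n : ℝ) : ℂ) * ((c + l.1 : ℝ) : ℂ) =
    ((fracP γ + n : ℝ) : ℂ) * (-2 * π * t * ((c + l.1 : ℝ) : ℂ)) := by ring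
  rw [this]; ring

lemma hasSum_int_of_pos_neg {c : ℝ} {g : ℤ → ℂ} {a b : ℂ} (h0 : ∀ n : ℤ, c + n = 0 → g n = 0)
    (hp : HasSum (fun n : {n : ℤ // 0 < c + (n : ℝ)} => g n.1) a)
    (hn : HasSum (fun n : {n : ℤ // 0 < -c + (n : ℝ)} => g (-n.1)) b) :
    HasSum g (a + b) := by
  have hn' : HasSum (fun n : {n : ℤ // c + (n : ℝ) < 0} => g n.1) b := by
    let e : {n : ℤ // 0 < -c + (n : ℝ)} ≃ {n : ℤ // c + (n : ℝ) < 0} :=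
      (Equiv.neg ℤ).subtypeEquiv fun n => by
        simp only [Equiv.neg_apply]; push_cast
        constructor <;> intro h <;> linarith
    rw [← e.hasSum_iff]
    exact hn
  have hdisj : Disjoint {n : ℤ | 0 < c + (n : ℝ)} {n : ℤ | c + (n : ℝ) < 0} :=
    Set.disjoint_left.mpr fun n h1 h2 => lt_asymm (show 0 < c + (n : ℝ) from h1) h2
  refine (hasSum_subtype_iff_of_support_subset ?_).mp (HasSum.add_disjoint hdisj hp hn')
  intro n hn
  rcases lt_trichotomy (c + (n : ℝ)) 0 with h | h | h
  · exact Or.inr h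
  · exact absurd (h0 n h) hn
  · exact Or.inl h

lemma yterm_neg (k : ℤ) (b c : ℝ) (n : ℤ) :
    yterm k (-b) (-c) (-n) = (-1) ^ k * yterm k b c n := by
  have h : -c + ((-n : ℤ) : ℝ) = -(c + n) := by push_cast; ring
  by_cases h0 : c + (n : ℝ) = 0
  · rw [yterm, yterm, if_pos h0, if_pos (by rw [h, h0, neg_zero]), mul_zero]
  · rw [yterm, yterm, if_neg h0, if_neg (by rwa [h, neg_eq_zero]), h,
      neg_mul_neg, Complex.ofReal_neg, ← neg_one_mul, mul_zpow, zpow_neg (-1 : ℂ),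
      ← inv_zpow, inv_neg, inv_one]
    ring

lemma genFun_reflect {x m : ℝ} {Z : ℂ} :
    ee ((-((1 - x) * m) : ℝ) : ℂ) * genFun (1 - x) (-m) (-Z) =
      -(ee ((x * m : ℝ) : ℂ) * genFun x m Z) := by
  simp only [genFun]
  have h1 : ee ((-m : ℝ) : ℂ) * Complex.exp (-Z) - 1 =
      -(ee m * Complex.exp Z - 1) * (ee ((-m : ℝ) : ℂ) * Complex.exp (-Z)) := by
    have h2 : ee ((-m : ℝ) : ℂ) * ee m = 1 := by rw [← ee_add]; push_cast; simp [ee_zero]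
    have h3 : Complex.exp (-Z) * Complex.exp Z = 1 := by rw [← Complex.exp_add]; simp
    linear_combination (Complex.exp (-Z) * Complex.exp Z) * h2 + h3
  have h4 : ee ((-((1 - x) * m) : ℝ) : ℂ) = ee ((x * m : ℝ) : ℂ) * ee ((-m : ℝ) : ℂ) := by
    rw [← ee_add]; congr 1; push_cast; ring
  have h5 : Complex.exp (((1 - x : ℝ) : ℂ) * -Z) = Complex.exp (x * Z) * Complex.exp (-Z) := by
    rw [← Complex.exp_add]; congr 1; push_cast; ring
  have h6 := ee_ne_zero ((-m : ℝ) : ℂ)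
  have h7 := Complex.exp_ne_zero (-Z)
  rw [h1, h4, h5, neg_mul, div_neg, mul_neg, mul_div_assoc', mul_div_assoc', mul_mul_mul_comm,
    mul_div_mul_right _ _ (mul_ne_zero h6 h7)]

lemma summable_lterm_of_pos_neg {k : ℤ} {e : ℝ} {x : ℤ → ℝ} (m b c : ℝ) {s : ℂ} (hs : s.re < 0)
    (he : 0 < e ∨ 0 ≤ e ∧ 2 ≤ k) (h0 : ∀ n : ℤ, 0 < c + n → e ≤ x n)
    (h1 : ∀ n : ℤ, c + n < 0 → x n ≤ 1 - e) :
    Summable fun n => lterm k (x n) m b c s n := by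
  obtain ⟨M, -, hM⟩ := exists_norm_lterm_le c hs
  have he' : 0 < e * -s.re ∨ 0 ≤ e * -s.re ∧ 2 ≤ k :=
    he.imp (fun h => mul_pos h (by linarith)) fun h => ⟨mul_nonneg h.1 (by linarith), h.2⟩
  exact Summable.of_norm_bounded ((summable_latBound c he').mul_left M)
    fun n => hM k (x n) m b e n (h0 n) (h1 n)

lemma lterm_eq_zero {k : ℤ} {a m b c : ℝ} {s : ℂ} {n : ℤ} (h : c + n = 0) :
    lterm k a m b c s n = 0 := by
  rw [lterm, yterm, if_pos h, zero_mul]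

lemma scal_add_scal (k : ℤ) (a c m b : ℝ) {t : ℂ} (ht : (-2 * π * t).re < 0) :
    Scal k a c m b t + (-1) ^ (k - 1) * Scal k (-a) (-c) (-m) (-b) t =
      -∑' n : ℤ, if 0 < c + (n : ℝ)
        then ee ((fracP a * m : ℝ) : ℂ) * lterm k (fracP a) m b c (-2 * π * t) n
        else ee ((Int.fract a * m : ℝ) : ℂ) * lterm k (Int.fract a) m b c (-2 * π * t) n := by
  set s := -2 * π * t with hsdef
  set G : ℤ → ℂ := fun n => if 0 < c + (n : ℝ)
        then ee ((fracP a * m : ℝ) : ℂ) * lterm k (fracP a) m b c s n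
        else ee ((Int.fract a * m : ℝ) : ℂ) * lterm k (Int.fract a) m b c s n with hG
  set x : ℤ → ℝ := fun n => if 0 < c + (n : ℝ) then fracP a else Int.fract a with hx
  have hsum : Summable G := by
    have h := summable_lterm_of_pos_neg (k := k) (x := x) (e := min (fracP a) (1 - Int.fract a)) m b c
      ht (Or.inl (lt_min (fracP_pos a) (by linarith [Int.fract_lt_one a])))
      (fun n hn => by simp only [hx, if_pos hn]; exact min_le_left _ _)
      (fun n hn => by
        simp only [hx, if_neg hn.not_gt]
        linarith [min_le_right (fracP a) (1 - Int.fract a)])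
    refine Summable.of_norm_bounded h.norm fun n => le_of_eq ?_
    simp only [hG, hx]
    split_ifs <;> rw [norm_mul, norm_ee, one_mul]
  have hp : HasSum (fun n : {n : ℤ // 0 < c + (n : ℝ)} => G n.1) (-Scal k a c m b t) := by
    rw [scal_eq_tsum k a c m b ht, neg_neg]
    convert! (hsum.subtype {n : ℤ | 0 < c + (n : ℝ)}).hasSum using 1
    exact tsum_congr fun n => (if_pos n.2).symm
  have hn : HasSum (fun n : {n : ℤ // 0 < -c + (n : ℝ)} => G (-n.1))
      (-((-1) ^ (k - 1) * Scal k (-a) (-c) (-m) (-b) t)) := by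
    have h1 := (((Equiv.neg ℤ).summable_iff.mpr hsum).subtype {n : ℤ | 0 < -c + (n : ℝ)}).hasSum
    convert! h1 using 1
    rw [scal_eq_tsum k (-a) (-c) (-m) (-b) ht, mul_neg, neg_neg, ← tsum_mul_left]
    refine tsum_congr fun n => ?_
    have hn : 0 < -c + ((n.1 : ℤ) : ℝ) := n.2
    have hneg : ¬ 0 < c + ((-n.1 : ℤ) : ℝ) := by push_cast; linarith
    have hfr : fracP (-a) = 1 - Int.fract a := by rw [fracP, neg_neg]
    simp only [Function.comp, Equiv.neg_apply, hG]
    rw [if_neg hneg, hfr, lterm, lterm]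
    have hy := yterm_neg k b c (-n.1)
    rw [neg_neg] at hy
    have hr := genFun_reflect (x := Int.fract a) (m := m) (Z := s * ((c + ((-n.1 : ℤ) : ℝ) : ℝ) : ℂ))
    have e1 : -(s * ((c + ((-n.1 : ℤ) : ℝ) : ℝ) : ℂ)) = s * ((-c + ((n.1 : ℤ) : ℝ) : ℝ) : ℂ) := by
      push_cast; ring
    have e2 : (-1 : ℂ) ^ (k - 1) * (-1) ^ k = -1 := by
      rw [← zpow_add₀ (by norm_num), show k - 1 + k = 2 * (k - 1) + 1 by ring,
        zpow_add₀ (by norm_num), zpow_mul]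
      norm_num
    rw [e1, ← mul_neg (1 - Int.fract a) m] at hr
    rw [hy, mul_left_comm (ee _), hr]
    linear_combination (-yterm k b c (-n.1) * (ee ((Int.fract a * m : ℝ) : ℂ) *
      genFun (Int.fract a) m (s * ((c + ((-n.1 : ℤ) : ℝ) : ℝ) : ℂ)))) * e2
  have := hasSum_int_of_pos_neg (g := G) (c := c) (fun n h => by
    simp only [hG, lterm_eq_zero h, mul_zero, ite_self]) hp hn
  rw [this.tsum_eq]; ring

/-- The terms of the lattice sum, with those at positive lattice points shifted so that the sum
remains absolutely convergent as `a` decreases to `0`. -/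
def rterm (k : ℤ) (a m b c : ℝ) (s : ℂ) (n : ℤ) : ℂ :=
  if 0 < c + (n : ℝ) then ee m * lterm k (a + 1) m b c s n else lterm k a m b c s n

/-- The sum over positive lattice points of `e(y b) y⁻ᵏ exp (a s y)`. -/
def posSum (k : ℤ) (b c : ℝ) (Z : ℂ) : ℂ :=
  ∑' n : {n : ℤ // 0 < c + (n : ℝ)}, yterm k b c n.1 * Complex.exp (((c + n.1 : ℝ) : ℂ) * Z)

lemma exists_norm_rterm_le (c : ℝ) {s : ℂ} (hs : s.re < 0) :
    ∃ M, 0 ≤ M ∧ ∀ (k : ℤ) (a m b e : ℝ) (n : ℤ), e ≤ a + 1 → a ≤ 1 - e →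
      ‖rterm k a m b c s n‖ ≤ M * latBound k c (e * -s.re) n := by
  obtain ⟨M, hM0, hM⟩ := exists_norm_lterm_le c hs
  refine ⟨M, hM0, fun k a m b e n h0 h1 => ?_⟩
  rw [rterm]
  split_ifs with h
  · rw [norm_mul, norm_ee, one_mul]
    exact hM _ _ _ _ _ _ (fun _ => h0) (fun h' => absurd h h'.not_gt)
  · exact hM _ _ _ _ _ _ (fun h' => absurd h' h) (fun _ => h1)

lemma summable_rterm (k : ℤ) {a : ℝ} (m b c : ℝ) {s : ℂ} (hs : s.re < 0) (h0 : 0 ≤ a) (h1 : a < 1) :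
    Summable (rterm k a m b c s) := by
  obtain ⟨M, -, hM⟩ := exists_norm_rterm_le c hs
  exact Summable.of_norm_bounded ((summable_latBound c
    (Or.inl (mul_pos (sub_pos.mpr h1) (by linarith : 0 < -s.re)))).mul_left M)
    fun n => hM k a m b (1 - a) n (by linarith) (by linarith)

lemma norm_posTerm_le (k : ℤ) (b c : ℝ) (Z : ℂ) (n : {n : ℤ // 0 < c + (n : ℝ)}) :
    ‖yterm k b c n.1 * Complex.exp (((c + n.1 : ℝ) : ℂ) * Z)‖ = latBound k c (-Z.re) n.1 := by
  rw [norm_mul, ← norm_yterm_mul_exp k b, Complex.norm_exp, Complex.re_ofReal_mul,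
    abs_of_pos n.2, neg_neg, mul_comm Z.re]

lemma summable_posSum {k : ℤ} (b c : ℝ) {Z : ℂ} (h : Z.re < 0 ∨ Z.re ≤ 0 ∧ 2 ≤ k) :
    Summable fun n : {n : ℤ // 0 < c + (n : ℝ)} =>
      yterm k b c n.1 * Complex.exp (((c + n.1 : ℝ) : ℂ) * Z) := by
  refine Summable.of_norm_bounded ((summable_latBound (k := k) c (δ := -Z.re) ?_).subtype _)
    fun n => (norm_posTerm_le k b c Z n).le
  exact h.imp (fun h => by linarith) fun h => ⟨by linarith [h.1], h.2⟩

lemma lsum_eq_rsum_sub_posSum {k : ℤ} {a : ℝ} (m b c : ℝ) {s : ℂ} (hs : s.re < 0)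
    (h0 : 0 < a ∨ 0 ≤ a ∧ 2 ≤ k) (h1 : a < 1) :
    lsum k a m b c s = ∑' n, rterm k a m b c s n - posSum k b c (a * s) := by
  have ha : 0 ≤ a := h0.elim le_of_lt And.left
  have hr := summable_rterm k m b c hs ha h1
  have hp : Summable fun n : {n : ℤ // 0 < c + (n : ℝ)} =>
      yterm k b c n.1 * Complex.exp (((c + n.1 : ℝ) : ℂ) * (a * s)) := by
    refine summable_posSum b c ?_
    rw [Complex.re_ofReal_mul]
    exact h0.imp (fun h => mul_neg_of_pos_of_neg h hs)
      fun h => ⟨mul_nonpos_of_nonneg_of_nonpos h.1 hs.le, h.2⟩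
  set f : ℤ → ℂ := fun n => yterm k b c n * Complex.exp (((c + n : ℝ) : ℂ) * (a * s)) with hf
  have h2 : HasSum ({n : ℤ | 0 < c + (n : ℝ)}.indicator f) (posSum k b c (a * s)) :=
    (hasSum_subtype_iff_indicator (f := f)).mp hp.hasSum
  rw [← (hr.hasSum.sub h2).tsum_eq, lsum]
  refine tsum_congr fun n => ?_
  by_cases h : 0 < c + (n : ℝ)
  · rw [Set.indicator_of_mem (show n ∈ {n : ℤ | 0 < c + (n : ℝ)} from h), rterm, if_pos h, hf,
      lterm, lterm]
    have h3 := sub_ne_zero.mpr (ee_mul_exp_ne_one_of_re (m := m) (re_mul_ofReal_ne_zero hs h.ne'))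
    have h4 : ee m * genFun (a + 1) m (s * ((c + n : ℝ) : ℂ)) -
        genFun a m (s * ((c + n : ℝ) : ℂ)) = Complex.exp (((c + n : ℝ) : ℂ) * (a * s)) := by
      have h5 : Complex.exp (((a + 1 : ℝ) : ℂ) * (s * ((c + n : ℝ) : ℂ))) =
        Complex.exp (a * (s * ((c + n : ℝ) : ℂ))) * Complex.exp (s * ((c + n : ℝ) : ℂ)) := by
        rw [← Complex.exp_add]; congr 1; push_cast; ring
      have h6 : ((c + n : ℝ) : ℂ) * (a * s) = a * (s * ((c + n : ℝ) : ℂ)) := by ring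
      rw [genFun, genFun, h5, h6]
      field_simp
    simp only
    rw [← h4]; ring
  · rw [Set.indicator_of_notMem (show n ∉ {n : ℤ | 0 < c + (n : ℝ)} from h), rterm, if_neg h,
      sub_zero]

lemma fracP_of_not_int {a : ℝ} (ha : ¬∃ n : ℤ, (n : ℝ) = a) : fracP a = Int.fract a := by
  have : Int.fract a ≠ 0 := fun h => ha ⟨⌊a⌋, by
    have := Int.self_sub_floor a; rw [h] at this; linarith⟩
  rw [fracP, Int.fract_neg this]; ring

/-- One side of the transformation formula: the `ψ` term together with the two `𝒮` series. -/
def sideSum (C : ℕ → ℂ → ℝ → ℂ) (k : ℤ) (a c m b : ℝ) (t : ℂ) : ℂ :=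
  dInt a * psiIntC C k c b + Scal k a c m b t + (-1) ^ (k - 1) * Scal k (-a) (-c) (-m) (-b) t

lemma sideSum_of_not_int (C : ℕ → ℂ → ℝ → ℂ) (k : ℤ) {a : ℝ} (c m b : ℝ) {t : ℂ}
    (ht : (-2 * π * t).re < 0) (ha : ¬∃ n : ℤ, (n : ℝ) = a) :
    sideSum C k a c m b t =
      -(ee ((Int.fract a * m : ℝ) : ℂ) * lsum k (Int.fract a) m b c (-2 * π * t)) := by
  rw [sideSum, add_assoc, scal_add_scal k a c m b ht, dInt, if_neg ha, zero_mul, zero_add,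
    fracP_of_not_int ha, lsum, ← tsum_mul_left]
  simp only [ite_self]

lemma sideSum_of_int (C : ℕ → ℂ → ℝ → ℂ) (k : ℤ) {a : ℝ} (c m b : ℝ) {t : ℂ}
    (ht : (-2 * π * t).re < 0) (ha : ∃ n : ℤ, (n : ℝ) = a) :
    sideSum C k a c m b t = psiIntC C k c b - ∑' n, rterm k 0 m b c (-2 * π * t) n := by
  rw [sideSum, add_assoc, scal_add_scal k a c m b ht, dInt, if_pos ha, one_mul, sub_eq_add_neg]
  obtain ⟨j, rfl⟩ := ha
  have h1 : fracP j = 1 := by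
    rw [fracP, ← Int.cast_neg, Int.fract_intCast, sub_zero]
  simp only [h1, Int.fract_intCast, rterm, zero_add, one_mul, zero_mul, Complex.ofReal_zero, ee_zero]

lemma sideSum_of_two_le (C : ℕ → ℂ → ℝ → ℂ) {k : ℤ} (hk : 2 ≤ k) {a : ℝ} (c m b : ℝ) {t : ℂ}
    (ht : (-2 * π * t).re < 0) :
    sideSum C k a c m b t =
      -(ee ((Int.fract a * m : ℝ) : ℂ) * lsum k (Int.fract a) m b c (-2 * π * t)) := by
  by_cases ha : ∃ n : ℤ, (n : ℝ) = a
  · rw [sideSum_of_int C k c m b ht ha]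
    obtain ⟨j, rfl⟩ := ha
    rw [Int.fract_intCast, lsum_eq_rsum_sub_posSum m b c ht (Or.inr ⟨le_rfl, hk⟩) one_pos]
    have : psiIntC C k c b = posSum k b c ((0 : ℝ) * (-2 * π * t)) := by
      rw [psiIntC, if_pos hk, posSum]
      refine tsum_congr fun n => ?_
      rw [yterm, if_neg n.2.ne']
      simp
    rw [this]
    simp only [zero_mul, Complex.ofReal_zero, ee_zero]
    ring
  · exact sideSum_of_not_int C k c m b ht ha

/-! ### The Lerch values at non-positive integers as regularized limits -/

lemma hasDerivAt_posSum (k : ℤ) (b c : ℝ) {Z : ℂ} (hZ : Z.re < 0) :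
    HasDerivAt (posSum k b c) (posSum (k - 1) b c Z) Z := by
  set U : Set ℂ := {w | w.re < Z.re / 2}
  have hU : IsOpen U := isOpen_lt Complex.continuous_re continuous_const
  have hUc : Convex ℝ U := convex_halfSpace_re_lt _
  have hmem : Z ∈ U := by show Z.re < Z.re / 2; linarith
  have hbound : Summable fun n : {n : ℤ // 0 < c + (n : ℝ)} =>
      latBound (k - 1) c (-Z.re / 2) n.1 :=
    (summable_latBound c (Or.inl (by linarith))).subtype _
  have hd : ∀ (n : {n : ℤ // 0 < c + (n : ℝ)}) (w : ℂ), HasDerivAt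
      (fun w => yterm k b c n.1 * Complex.exp (((c + n.1 : ℝ) : ℂ) * w))
      (yterm (k - 1) b c n.1 * Complex.exp (((c + n.1 : ℝ) : ℂ) * w)) w := fun n w => by
    have h := ((hasDerivAt_id w).const_mul ((c + n.1 : ℝ) : ℂ)).cexp.const_mul (yterm k b c n.1)
    refine h.congr_deriv ?_
    rw [yterm_sub_one]; simp only [id]; ring
  have hle : ∀ (n : {n : ℤ // 0 < c + (n : ℝ)}) (w : ℂ), w ∈ U →
      ‖yterm (k - 1) b c n.1 * Complex.exp (((c + n.1 : ℝ) : ℂ) * w)‖ ≤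
        latBound (k - 1) c (-Z.re / 2) n.1 := fun n w hw => by
    rw [norm_posTerm_le]
    simp only [latBound, if_neg n.2.ne']
    refine mul_le_mul_of_nonneg_left (Real.exp_le_exp.mpr ?_) (zpow_nonneg (abs_nonneg _) _)
    have hw : w.re < Z.re / 2 := hw
    exact mul_le_mul_of_nonneg_right (by linarith) (abs_nonneg _)
  exact hasDerivAt_tsum_of_isPreconnected hbound hU hUc.isPreconnected (fun n w _ => hd n w)
    hle hmem (summable_posSum b c (Or.inl hZ)) hmem

lemma posSum_zero (b c : ℝ) {Z : ℂ} (hZ : Z.re < 0) :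
    posSum 0 b c Z = -(ee ((Int.fract c * b : ℝ) : ℂ) * genFun (Int.fract c) b Z) - dInt c := by
  have h1 : posSum 0 b c Z = -(ee ((fracP c * b : ℝ) : ℂ) * genFun (fracP c) b Z) := by
    obtain ⟨e, he⟩ := exists_posEquiv c
    rw [posSum, ← e.tsum_eq, ← (hasSum_geometric_ee hZ).tsum_eq]
    refine tsum_congr fun n => ?_
    rw [yterm, if_neg (e n).2.ne', he]
    simp
  rw [h1, dInt]
  split_ifs with hc
  · obtain ⟨n, rfl⟩ := hc
    have h2 : fracP n = 1 := by rw [fracP, ← Int.cast_neg, Int.fract_intCast, sub_zero]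
    have h3 : ee b * Complex.exp Z - 1 ≠ 0 :=
      sub_ne_zero.mpr (ee_mul_exp_ne_one_of_re hZ.ne)
    rw [h2, Int.fract_intCast]
    simp only [genFun, one_mul, zero_mul, Complex.ofReal_zero, Complex.ofReal_one, ee_zero,
      Complex.exp_zero]
    field_simp
    ring
  · rw [fracP_of_not_int hc, sub_zero]

/-- The analytic part of `genFun x m` at the origin. -/
lemma exists_genFun_eq {C : ℕ → ℂ → ℝ → ℂ} (hC : IsTaylor C) (m x : ℝ) :
    ∃ H : ℂ → ℂ, AnalyticAt ℂ H 0 ∧ (∀ Z ≠ 0, genFun x m Z = bern C m 0 x / Z + H Z) ∧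
      ∀ j, iteratedDeriv j H 0 = Nat.factorial j * bern C m (j + 1) x := by
  set H : ℂ → ℂ := fun Z => if Z = 0 then bern C m 1 x else genFun x m Z - bern C m 0 x / Z with hH
  have hf : HasFPowerSeriesAt H
      (FormalMultilinearSeries.ofScalars ℂ fun j => bern C m (j + 1) x) 0 := by
    rw [hasFPowerSeriesAt_iff']
    have hb := hasSum_bern hC m x
    rw [eventually_nhdsWithin_iff] at hb
    filter_upwards [hb] with Z hZ
    by_cases h0 : Z = 0
    · subst h0
      simp only [hH, sub_zero, if_true]
      convert! hasSum_single (α := ℂ) 0 _ using 1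
      · simp
      · intro n hn; simp [hn]
    · have h1 := ((hasSum_nat_add_iff' 1).mpr (hZ h0)).div_const Z
      simp only [hH, h0, if_false, sub_zero]
      convert! h1 using 1
      · ext j
        rw [FormalMultilinearSeries.coeff_ofScalars, smul_eq_mul, pow_succ]
        field_simp
      · simp; field_simp
  refine ⟨H, hf.analyticAt, fun Z hZ => by simp [hH, hZ], fun j => ?_⟩
  have h2 := congrArg (fun p => p.coeff j)
    (hf.eq_formalMultilinearSeries hf.analyticAt.hasFPowerSeriesAt)
  simp only [FormalMultilinearSeries.coeff_ofScalars] at h2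
  have hj : (Nat.factorial j : ℂ) ≠ 0 := by exact_mod_cast Nat.factorial_ne_zero j
  rw [h2]; field_simp

lemma analyticAt_iteratedDeriv {f : ℂ → ℂ} {z : ℂ} (hf : AnalyticAt ℂ f z) (n : ℕ) :
    AnalyticAt ℂ (iteratedDeriv n f) z := by
  rw [iteratedDeriv_eq_iterate]
  exact hf.iterated_deriv n

lemma tendsto_posSum_sub {C : ℕ → ℂ → ℝ → ℂ} (hC : IsTaylor C) (m : ℕ) (b c : ℝ) :
    Filter.Tendsto (fun Z => posSum (-m) b c Z -
        C 0 (Int.fract c : ℝ) b * (Nat.factorial m / (-Z) ^ (m + 1)))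
      (nhdsWithin 0 {Z | Z.re < 0}) (nhds (psiIntC C (-m) c b)) := by
  obtain ⟨H, hH, hgen, hcoef⟩ := exists_genFun_eq hC b (Int.fract c)
  obtain ⟨V, hV, hVo, hV0⟩ := eventually_nhds_iff.mp hH.eventually_analyticAt
  set E := ee ((Int.fract c * b : ℝ) : ℂ)
  have key : ∀ m : ℕ, ∀ Z ∈ V ∩ {Z : ℂ | Z.re < 0}, posSum (-m) b c Z =
      E * bern C b 0 (Int.fract c) * (Nat.factorial m / (-Z) ^ (m + 1)) -
        E * iteratedDeriv m H Z - (if m = 0 then dInt c else 0) := by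
    have hW : IsOpen (V ∩ {Z : ℂ | Z.re < 0}) :=
      hVo.inter (isOpen_lt Complex.continuous_re continuous_const)
    have hne : ∀ Z : ℂ, Z.re < 0 → Z ≠ 0 := by rintro Z h rfl; simp at h
    intro m
    induction m with
    | zero =>
      rintro Z ⟨-, hZ⟩
      have := hne Z hZ
      simp only [Nat.cast_zero, neg_zero, posSum_zero b c hZ, hgen Z this, if_true,
        iteratedDeriv_zero]
      simp only [Nat.factorial_zero, Nat.cast_one, zero_add, pow_one]
      field_simp
      ring
    | succ m ih =>
      rintro Z ⟨hZV, hZ⟩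
      have h0 := hne Z hZ
      have h1 := hasDerivAt_posSum (-m) b c hZ
      have h2 : HasDerivAt (iteratedDeriv m H) (iteratedDeriv (m + 1) H Z) Z := by
        rw [iteratedDeriv_succ]
        exact (analyticAt_iteratedDeriv (hV Z hZV) m).differentiableAt.hasDerivAt
      have h3 : HasDerivAt (fun Z : ℂ => (Nat.factorial m : ℂ) / (-Z) ^ (m + 1))
          (Nat.factorial (m + 1) / (-Z) ^ (m + 1 + 1)) Z := by
        have h4 := ((hasDerivAt_id Z).fun_neg.fun_pow (m + 1))
        have h5 : (-Z) ^ (m + 1) ≠ 0 := pow_ne_zero _ (neg_ne_zero.mpr h0)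
        refine ((hasDerivAt_const Z (Nat.factorial m : ℂ)).fun_div h4 h5).congr_deriv ?_
        rw [Nat.factorial_succ]
        have h6 := neg_ne_zero.mpr h0
        simp only [id]
        push_cast
        rw [pow_succ (-Z) (m + 1), pow_succ (-Z) m]
        field_simp
        ring
      have h4 := ((h3.const_mul (E * bern C b 0 (Int.fract c))).fun_sub (h2.const_mul E)).sub_const
        (if m = 0 then dInt c else 0)
      have h5 := (h4.congr_of_eventuallyEq
        (Filter.eventuallyEq_of_mem (hW.mem_nhds ⟨hZV, hZ⟩) ih)).unique h1
      rw [if_neg (Nat.succ_ne_zero m), sub_zero, h5]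
      congr 1; push_cast; ring
  have hlim : Filter.Tendsto (fun Z => -(E * iteratedDeriv m H Z) - (if m = 0 then dInt c else 0))
      (nhdsWithin 0 {Z | Z.re < 0}) (nhds (psiIntC C (-m) c b)) := by
    have : psiIntC C (-m) c b = -(E * iteratedDeriv m H 0) - (if m = 0 then dInt c else 0) := by
      rw [psiIntC, if_neg (by omega), if_pos (by omega), hcoef]
      have e1 : (1 - -(m : ℤ)).toNat = m + 1 := by omega
      have e2 : (m + 1 : ℂ) ≠ 0 := by exact_mod_cast Nat.succ_ne_zero m
      rw [e1, C_eq_bern hC, Nat.factorial_succ]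
      simp only [neg_eq_zero, Nat.cast_eq_zero]
      congr 1
      rw [Int.cast_neg, Int.cast_natCast, sub_neg_eq_add, add_comm 1 (m : ℂ), Nat.cast_mul,
        Nat.cast_succ, neg_div]
      congr 1
      field_simp
      ring
    rw [this]
    exact (((analyticAt_iteratedDeriv hH m).continuousAt.tendsto.mono_left nhdsWithin_le_nhds).const_mul
      E).neg.sub_const _
  refine hlim.congr' ?_
  filter_upwards [self_mem_nhdsWithin, nhdsWithin_le_nhds (hVo.mem_nhds hV0)] with Z h1 h2
  rw [key m Z ⟨h2, h1⟩, C_eq_bern hC]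
  simp only [Nat.factorial_zero, Nat.cast_one, one_mul]
  ring

lemma tendsto_lterm (k : ℤ) (a m b c σ : ℝ) (s : ℂ) (n : ℤ) :
    Filter.Tendsto (fun ε : ℝ => lterm k (a + ε) m (b + σ * ε) c s n) (nhdsWithin 0 (Set.Ioi 0))
      (nhds (lterm k a m b c s n)) := by
  have h1 : Continuous fun b => yterm k b c n :=
    continuous_iff_continuousAt.mpr fun b => (hasDerivAt_yterm k b c n).continuousAt
  have h2 : Continuous fun a => genFun a m (s * ((c + n : ℝ) : ℂ)) :=
    continuous_iff_continuousAt.mpr fun a => (hasDerivAt_genFun m _ a).continuousAt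
  have h3 : Continuous fun ε : ℝ => lterm k (a + ε) m (b + σ * ε) c s n :=
    (h1.comp (by fun_prop : Continuous fun ε : ℝ => b + σ * ε)).mul
      (h2.comp (by fun_prop : Continuous fun ε : ℝ => a + ε))
  simpa using (h3.tendsto 0).mono_left nhdsWithin_le_nhds

lemma tendsto_lsum {a : ℝ} (k : ℤ) (m b c σ : ℝ) {s : ℂ} (hs : s.re < 0)
    (ha : a ∈ Set.Ioo (0 : ℝ) 1) :
    Filter.Tendsto (fun ε : ℝ => lsum k (a + ε) m (b + σ * ε) c s) (nhdsWithin 0 (Set.Ioi 0))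
      (nhds (lsum k a m b c s)) := by
  obtain ⟨M, -, hM⟩ := exists_norm_lterm_le c hs
  set e := min a ((1 - a) / 2) with he
  have he0 : 0 < e := lt_min ha.1 (by linarith [ha.2])
  refine tendsto_tsum_of_dominated_convergence
    ((summable_latBound (k := k) c (Or.inl (mul_pos he0 (by linarith : 0 < -s.re)))).mul_left M)
    (fun n => tendsto_lterm k a m b c σ s n) ?_
  filter_upwards [Ioo_mem_nhdsGT he0] with ε hε n
  have h1 := min_le_left a ((1 - a) / 2)
  have h2 := min_le_right a ((1 - a) / 2)
  exact hM k _ m _ e n (fun _ => by linarith [hε.1]) (fun _ => by linarith [hε.2])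

lemma tendsto_tsum_rterm (k : ℤ) (m b c σ : ℝ) {s : ℂ} (hs : s.re < 0) :
    Filter.Tendsto (fun ε : ℝ => ∑' n, rterm k ε m (b + σ * ε) c s n) (nhdsWithin 0 (Set.Ioi 0))
      (nhds (∑' n, rterm k 0 m b c s n)) := by
  obtain ⟨M, -, hM⟩ := exists_norm_rterm_le c hs
  refine tendsto_tsum_of_dominated_convergence
    ((summable_latBound (k := k) c (Or.inl (mul_pos one_half_pos (by linarith : 0 < -s.re)))).mul_left M)
    (fun n => ?_) ?_
  · unfold rterm
    split_ifs with h
    · simpa [add_comm] using (tendsto_lterm k 1 m b c σ s n).const_mul (ee m)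
    · simpa using tendsto_lterm k 0 m b c σ s n
  · filter_upwards [Ioo_mem_nhdsGT (one_half_pos (α := ℝ))] with ε hε n
    exact hM k ε m _ (1 / 2) n (by linarith [hε.1]) (by linarith [hε.2])

lemma yterm_add (k : ℤ) (b d c : ℝ) (n : ℤ) :
    yterm k (b + d) c n = ee (((c + n) * d : ℝ) : ℂ) * yterm k b c n := by
  simp only [yterm]
  split_ifs with h
  · rw [mul_zero]
  · rw [mul_add, Complex.ofReal_add, ee_add]; ring

lemma posSum_add (k : ℤ) (b d c : ℝ) (Z : ℂ) :
    posSum k (b + d) c Z = posSum k b c (Z + 2 * π * I * d) := by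
  refine tsum_congr fun n => ?_
  rw [yterm_add, mul_add, Complex.exp_add, ee]
  push_cast
  have : 2 * (π : ℂ) * I * ((c + n.1) * d) = (c + n.1) * (2 * π * I * d) := by ring
  rw [this]; ring

lemma re_shift (σ : ℝ) (t : ℂ) :
    (2 * π * (t - I * σ)).re = -(-2 * π * t).re := by
  simp [Complex.mul_re, Complex.mul_im]

lemma fract_mem_Ioo {x : ℝ} (hx : ¬∃ n : ℤ, (n : ℝ) = x) : Int.fract x ∈ Set.Ioo (0 : ℝ) 1 := by
  refine ⟨(Int.fract_nonneg x).lt_of_ne' fun h => hx ⟨⌊x⌋, ?_⟩, Int.fract_lt_one x⟩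
  have := Int.self_sub_floor x; rw [h] at this; linarith

/-- The regularization at `k ≤ 0`: the side sum is the limit of lattice sums with the pole in
the regularization parameter removed. -/
lemma tendsto_lsum_sub_pole {C : ℕ → ℂ → ℝ → ℂ} (hC : IsTaylor C) (N : ℕ) (a c m b σ : ℝ) {t : ℂ}
    (ht : (-2 * π * t).re < 0) :
    Filter.Tendsto (fun ε : ℝ =>
        -(ee ((Int.fract a * m : ℝ) : ℂ) *
          lsum (-N) (Int.fract a + ε) m (b + σ * ε) c (-2 * π * t)) -
        dInt a * (C 0 (Int.fract c : ℝ) b *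
          (Nat.factorial N / (2 * π * (t - I * σ) * ε) ^ (N + 1))))
      (nhdsWithin 0 (Set.Ioi 0)) (nhds (sideSum C (-N) a c m b t)) := by
  by_cases ha : ∃ n : ℤ, (n : ℝ) = a
  · rw [sideSum_of_int C _ c m b ht ha, dInt, if_pos ha]
    obtain ⟨j, rfl⟩ := ha
    set v := 2 * π * (t - I * σ) with hv
    have hvre : 0 < v.re := by rw [hv, re_shift σ t]; linarith
    have h1 : Filter.Tendsto (fun ε : ℝ => -(v * ε)) (nhdsWithin 0 (Set.Ioi 0))
        (nhdsWithin 0 {Z : ℂ | Z.re < 0}) := by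
      refine tendsto_nhdsWithin_iff.mpr ⟨?_, ?_⟩
      · have : Continuous fun ε : ℝ => -(v * ε) := by fun_prop
        simpa using (this.tendsto 0).mono_left nhdsWithin_le_nhds
      · filter_upwards [self_mem_nhdsWithin] with ε hε
        show (-(v * ε)).re < 0
        rw [Complex.neg_re, mul_comm, Complex.re_ofReal_mul]
        exact neg_neg_of_pos (mul_pos hε hvre)
    have h2 := ((tendsto_posSum_sub hC N b c).comp h1).sub (tendsto_tsum_rterm (-N) m b c σ ht)
    refine h2.congr' ?_
    filter_upwards [Ioo_mem_nhdsGT (one_pos (α := ℝ))] with ε hε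
    rw [Int.fract_intCast, zero_add, lsum_eq_rsum_sub_posSum m _ c ht (Or.inl hε.1) hε.2, posSum_add]
    simp only [Function.comp, neg_neg, zero_mul, Complex.ofReal_zero, ee_zero, one_mul]
    have : (ε : ℂ) * (-2 * π * t) + 2 * π * I * ((σ * ε : ℝ) : ℂ) = -(v * ε) := by
      rw [hv]; push_cast; ring
    rw [this]; ring
  · rw [sideSum_of_not_int C _ c m b ht ha, dInt, if_neg ha]
    simp only [zero_mul, sub_zero]
    exact ((tendsto_lsum (-N) m b c σ ht (fract_mem_Ioo ha)).const_mul _).neg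

/-! ### The transformation formula -/

lemma lsum_add_int (k : ℤ) (a m b c : ℝ) (s : ℂ) (N : ℤ) :
    lsum k a m (b + N) c s = ee ((c * N : ℝ) : ℂ) * lsum k a m b c s := by
  rw [lsum, lsum, ← tsum_mul_left]
  refine tsum_congr fun n => ?_
  have : ee (((c + n) * N : ℝ) : ℂ) = ee ((c * N : ℝ) : ℂ) := by
    rw [add_mul, Complex.ofReal_add, ee_add]
    have h := ee_int (n * N)
    push_cast at h ⊢
    rw [h, mul_one]
  rw [lterm, yterm_add, this, lterm, mul_assoc]

lemma dInt_eq (x : ℝ) : dInt x = if ee x = 1 then 1 else 0 := by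
  rw [dInt]
  refine if_congr ?_ rfl rfl
  rw [ee_eq_one_iff]
  refine exists_congr fun n => ?_
  rw [eq_comm]
  norm_cast

lemma dInt_neg (x : ℝ) : dInt (-x) = dInt x := by
  rw [dInt_eq, dInt_eq]
  refine if_congr ?_ rfl rfl
  rw [Complex.ofReal_neg, ee_neg, inv_eq_one]

lemma C_zero_fract {C : ℕ → ℂ → ℝ → ℂ} (hC : IsTaylor C) (c b : ℝ) :
    C 0 (Int.fract c : ℝ) b = ee ((c * b : ℝ) : ℂ) * dInt b := by
  rw [C_eq_bern hC, (isAppell_bern hC b).zero_eq_ite, dInt_eq]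
  split_ifs with h
  · obtain ⟨n, hn⟩ := (ee_eq_one_iff _).mp h
    have hb : b = n := by exact_mod_cast hn
    have h1 := ee_int (⌊c⌋ * n)
    have h2 : c * b = Int.fract c * b + ((⌊c⌋ * n : ℤ) : ℝ) := by
      rw [Int.fract, hb]; push_cast; ring
    rw [h2, Complex.ofReal_add, ee_add, Complex.ofReal_intCast, h1]
    simp
  · simp

lemma polyPart_bern {C : ℕ → ℂ → ℝ → ℂ} (hC : IsTaylor C) (k : ℤ) (μ ν x y : ℝ) (τ : ℂ) :
    ee ((x * μ : ℝ) : ℂ) * ee ((y * ν : ℝ) : ℂ) *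
        polyPart k (fun j => bern C μ j x) (fun j => bern C ν j y) (-I * τ) =
      (-2 * (π : ℂ)) ^ k * ∑ j ∈ Finset.range (k + 2).toNat,
        (-I) ^ j * C j (x : ℂ) μ * C ((k + 1).toNat - j) (y : ℂ) ν /
          ((Nat.factorial j : ℂ) * (Nat.factorial ((k + 1).toNat - j) : ℂ)) * τ ^ (k - (j : ℤ)) := by
  rw [polyPart, Finset.mul_sum, Finset.mul_sum, Finset.mul_sum]
  refine Finset.sum_congr rfl fun j _ => ?_
  rw [C_eq_bern hC, C_eq_bern hC]
  have h1 : (Nat.factorial j : ℂ) ≠ 0 := by exact_mod_cast Nat.factorial_ne_zero j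
  have h2 : (Nat.factorial ((k + 1).toNat - j) : ℂ) ≠ 0 := by
    exact_mod_cast Nat.factorial_ne_zero _
  have h3 : (-2 * π * I : ℂ) ^ k * (-1) ^ j * (-I * τ) ^ (k - (j : ℤ)) =
      (-2 * (π : ℂ)) ^ k * (-I) ^ j * τ ^ (k - (j : ℤ)) := by
    have h4 : (-I : ℂ) ^ (k - (j : ℤ)) * I ^ k * (-1) ^ j = (-I) ^ j := by
      have h5 : (-I : ℂ) ^ k * I ^ k = 1 := by
        rw [← mul_zpow, neg_mul, I_mul_I, neg_neg, one_zpow]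
      have h6 : ((-I : ℂ) ^ j)⁻¹ * (-1) ^ j = (-I) ^ j := by
        rw [← inv_pow, ← mul_pow, inv_neg, inv_I, neg_neg, mul_neg_one]
      rw [zpow_sub₀ (neg_ne_zero.mpr I_ne_zero), zpow_natCast, div_eq_mul_inv,
        mul_right_comm ((-I : ℂ) ^ k), h5, one_mul, h6]
    rw [mul_zpow, mul_zpow (-I), ← h4]; ring
  generalize (-2 * π * I : ℂ) ^ k = A₁ at h3 ⊢
  generalize (-I * τ) ^ (k - (j : ℤ)) = A₂ at h3 ⊢
  generalize (-2 * π : ℂ) ^ k = A₃ at h3 ⊢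
  generalize (-I : ℂ) ^ j = A₄ at h3 ⊢
  field_simp
  linear_combination (ee ((x * μ : ℝ) : ℂ) * ee ((y * ν : ℝ) : ℂ) * bern C μ j x *
    bern C ν ((k + 1).toNat - j) y) * h3

lemma lsum_reciprocity_fract {k : ℤ} {p q : ℕ → ℝ → ℂ} {α β μ ν ε : ℝ} {τ : ℂ}
    (h : lsum k (Int.fract β + ε) ν (Int.fract α + ε) (-μ) (-2 * π * τ) +
        polyPart k (fun j => p j (Int.fract α + ε)) (fun j => q j (Int.fract β + ε)) (-I * τ) =
      (-I * τ) ^ (k - 1) *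
        lsum k (Int.fract α + ε) μ (-(Int.fract β + ε)) ν (-2 * π * (1 / τ))) :
    ee ((α * μ : ℝ) : ℂ) * -(ee ((Int.fract β * ν : ℝ) : ℂ) *
          lsum k (Int.fract β + ε) ν (α + 1 * ε) (-μ) (-2 * π * τ)) -
        ee ((Int.fract α * μ : ℝ) : ℂ) * ee ((Int.fract β * ν : ℝ) : ℂ) *
          polyPart k (fun j => p j (Int.fract α + ε)) (fun j => q j (Int.fract β + ε)) (-I * τ) =
      ee ((β * ν : ℝ) : ℂ) * (-I * τ) ^ (k - 1) * -(ee ((Int.fract α * μ : ℝ) : ℂ) *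
          lsum k (Int.fract α + ε) μ (-β + -1 * ε) ν (-2 * π * (1 / τ))) := by
  have h1 : α + 1 * ε = Int.fract α + ε + (⌊α⌋ : ℤ) := by rw [Int.fract]; ring
  have h2 : -β + -1 * ε = -(Int.fract β + ε) + ((-⌊β⌋ : ℤ) : ℝ) := by
    rw [Int.fract]; push_cast; ring
  have h3 : ee ((α * μ : ℝ) : ℂ) * ee ((-μ * (⌊α⌋ : ℤ) : ℝ) : ℂ) =
      ee ((Int.fract α * μ : ℝ) : ℂ) := by
    rw [← ee_add, ← Complex.ofReal_add, Int.fract]; congr 2; ring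
  have h4 : ee ((β * ν : ℝ) : ℂ) * ee ((ν * ((-⌊β⌋ : ℤ) : ℝ) : ℝ) : ℂ) =
      ee ((Int.fract β * ν : ℝ) : ℂ) := by
    rw [← ee_add, ← Complex.ofReal_add, Int.fract]; congr 2; push_cast; ring
  rw [h1, h2, lsum_add_int, lsum_add_int, ← h3, ← h4]
  linear_combination (-(ee ((α * μ : ℝ) : ℂ) * ee ((-μ * (⌊α⌋ : ℤ) : ℝ) : ℂ) *
    (ee ((β * ν : ℝ) : ℂ) * ee ((ν * ((-⌊β⌋ : ℤ) : ℝ) : ℝ) : ℂ)))) * h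

lemma neg_two_pi_mul_re {τ : ℂ} (hτ : 0 < τ.re) : (-2 * π * τ).re < 0 := by
  have : -2 * π * τ = ((-2 * π : ℝ) : ℂ) * τ := by push_cast; ring
  rw [this, Complex.re_ofReal_mul]
  nlinarith [mul_pos Real.pi_pos hτ]

lemma one_div_re_pos {τ : ℂ} (hτ : 0 < τ.re) : 0 < (1 / τ).re := by
  have h0 : τ ≠ 0 := by rintro rfl; simp at hτ
  rw [one_div, Complex.inv_re]
  exact div_pos hτ (Complex.normSq_pos.mpr h0)

lemma lsum_reciprocity_mul_neg_I {μ ν : ℝ} {p q : ℕ → ℝ → ℂ} (hp : IsAppell μ p)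
    (hq : IsAppell ν q) (k : ℤ) {τ : ℂ} (hτ : 0 < τ.re) {x y : ℝ}
    (h : 2 ≤ k ∧ x ∈ Set.Icc (0 : ℝ) 1 ∧ y ∈ Set.Icc (0 : ℝ) 1 ∨
      x ∈ Set.Ioo (0 : ℝ) 1 ∧ y ∈ Set.Ioo (0 : ℝ) 1) :
    lsum k y ν x (-μ) (-2 * π * τ) + polyPart k (fun j => p j x) (fun j => q j y) (-I * τ) =
      (-I * τ) ^ (k - 1) * lsum k x μ (-y) ν (-2 * π * (1 / τ)) := by
  have h0 : τ ≠ 0 := by rintro rfl; simp at hτ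
  have hu : -I * τ ≠ 0 := mul_ne_zero (neg_ne_zero.mpr I_ne_zero) h0
  have e1 : -2 * π * I * (-I * τ) = -2 * π * τ := by linear_combination (2 * π * τ) * I_mul_I
  have e2 : -(-2 * π * I) / (-I * τ) = -2 * π * (1 / τ) := by field_simp [I_ne_zero]
  have hs := neg_two_pi_mul_re hτ
  have hs' := neg_two_pi_mul_re (one_div_re_pos hτ)
  rw [← e1] at hs ⊢
  rw [← e2] at hs' ⊢
  rcases h with ⟨hk, hx, hy⟩ | ⟨hx, hy⟩
  · lift k to ℕ using by omega
    exact lsum_reciprocity_nat hp hq (by exact_mod_cast hk) hu hs hs' hx hy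
  · exact lsum_reciprocity hp hq k hu hs hs' hx hy

/-- The two poles produced by the regularization match. -/
lemma pole_eq {C : ℕ → ℂ → ℝ → ℂ} (hC : IsTaylor C) (N : ℕ) (α β μ ν ε : ℝ) {τ : ℂ}
    (hτ : τ ≠ 0) :
    ee ((α * μ : ℝ) : ℂ) * (dInt β * (C 0 (Int.fract (-μ) : ℝ) α *
        (Nat.factorial N / (2 * π * (τ - I * (1 : ℝ)) * ε) ^ (N + 1)))) =
      ee ((β * ν : ℝ) : ℂ) * (-I * τ) ^ (-(N : ℤ) - 1) *
        (dInt α * (C 0 (Int.fract ν : ℝ) (-β) *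
          (Nat.factorial N / (2 * π * (1 / τ - I * (-1 : ℝ)) * ε) ^ (N + 1)))) := by
  have h1 : ee ((α * μ : ℝ) : ℂ) * ee ((-μ * α : ℝ) : ℂ) = 1 := by
    rw [← ee_add, ← Complex.ofReal_add, ← ee_zero]; congr 1; push_cast; ring
  have h2 : ee ((β * ν : ℝ) : ℂ) * ee ((ν * -β : ℝ) : ℂ) = 1 := by
    rw [← ee_add, ← Complex.ofReal_add, ← ee_zero]; congr 1; push_cast; ring
  have h3 : 2 * π * (τ - I * (1 : ℝ)) * ε =
      (-I * τ) * (2 * π * (1 / τ - I * (-1 : ℝ)) * ε) := by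
    push_cast
    field_simp
    linear_combination (τ * ε : ℂ) * I_mul_I
  have h4 : (-I * τ) ^ (-(N : ℤ) - 1) = ((-I * τ) ^ (N + 1))⁻¹ := by
    rw [← zpow_natCast, ← zpow_neg]; congr 1; push_cast; ring
  rw [C_zero_fract hC, C_zero_fract hC, dInt_neg, h3, h4, mul_pow (-I * τ), div_mul_eq_div_div_swap,
    div_eq_mul_inv _ ((-I * τ) ^ (N + 1))]
  generalize (Nat.factorial N : ℂ) / (2 * π * (1 / τ - I * (-1 : ℝ)) * ε) ^ (N + 1) = Q
  generalize ((-I * τ) ^ (N + 1))⁻¹ = R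
  linear_combination (dInt β * dInt α * Q * R) * (h1 - h2)

lemma continuous_polyPart {p q : ℕ → ℝ → ℂ} (hp : ∀ j, Continuous (p j))
    (hq : ∀ j, Continuous (q j)) (k : ℤ) (x y : ℝ) (u : ℂ) :
    Continuous fun ε : ℝ => polyPart k (fun j => p j (x + ε)) (fun j => q j (y + ε)) u := by
  refine continuous_const.mul (continuous_finsetSum _ fun j _ => ?_)
  exact ((continuous_const.mul ((hp j).comp (by fun_prop))).mul
    ((hq _).comp (by fun_prop))).mul continuous_const

lemma sideSum_transformation {C : ℕ → ℂ → ℝ → ℂ} (hC : IsTaylor C) (α β μ ν : ℝ) (k : ℤ)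
    (hk : k = 1 → (¬∃ n : ℤ, (n : ℝ) = α) ∧ (¬∃ n : ℤ, (n : ℝ) = β)) {τ : ℂ} (hτ : 0 < τ.re) :
    ee ((α * μ : ℝ) : ℂ) * sideSum C k β (-μ) ν α τ -
        ee ((Int.fract α * μ : ℝ) : ℂ) * ee ((Int.fract β * ν : ℝ) : ℂ) *
          polyPart k (fun j => bern C μ j (Int.fract α)) (fun j => bern C ν j (Int.fract β))
            (-I * τ) =
      ee ((β * ν : ℝ) : ℂ) * (-I * τ) ^ (k - 1) * sideSum C k α ν μ (-β) (1 / τ) := by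
  have hp := isAppell_bern hC μ
  have hq := isAppell_bern hC ν
  have ht := neg_two_pi_mul_re hτ
  have ht' := neg_two_pi_mul_re (one_div_re_pos hτ)
  have hτ0 : τ ≠ 0 := by rintro rfl; simp at hτ
  rcases le_or_gt k 0 with hk0 | hk0
  · obtain ⟨N, rfl⟩ : ∃ N : ℕ, k = -N := ⟨(-k).toNat, by omega⟩
    have hl := ((tendsto_lsum_sub_pole hC N β (-μ) ν α 1 ht).const_mul
      (ee ((α * μ : ℝ) : ℂ))).sub ((((continuous_polyPart hp.continuous hq.continuous (-N)
        (Int.fract α) (Int.fract β) (-I * τ)).tendsto 0).mono_left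
          (nhdsWithin_le_nhds (s := Set.Ioi 0))).const_mul
        (ee ((Int.fract α * μ : ℝ) : ℂ) * ee ((Int.fract β * ν : ℝ) : ℂ)))
    have hr := (tendsto_lsum_sub_pole hC N α ν μ (-β) (-1) ht').const_mul
      (ee ((β * ν : ℝ) : ℂ) * (-I * τ) ^ (-(N : ℤ) - 1))
    simp only [add_zero] at hl
    refine tendsto_nhds_unique (hl.congr' ?_) hr
    have hmin : 0 < min (1 - Int.fract α) (1 - Int.fract β) :=
      lt_min (by linarith [Int.fract_lt_one α]) (by linarith [Int.fract_lt_one β])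
    filter_upwards [Ioo_mem_nhdsGT hmin] with ε hε
    have hα : Int.fract α + ε ∈ Set.Ioo (0 : ℝ) 1 :=
      ⟨by linarith [Int.fract_nonneg α, hε.1], by linarith [lt_min_iff.mp hε.2]⟩
    have hβ : Int.fract β + ε ∈ Set.Ioo (0 : ℝ) 1 :=
      ⟨by linarith [Int.fract_nonneg β, hε.1], by linarith [lt_min_iff.mp hε.2]⟩
    have h1 := lsum_reciprocity_fract
      (lsum_reciprocity_mul_neg_I hp hq (-N) hτ (Or.inr ⟨hα, hβ⟩))
    have h2 := pole_eq hC N α β μ ν ε hτ0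
    linear_combination h1 - h2
  · have hside : sideSum C k β (-μ) ν α τ =
        -(ee ((Int.fract β * ν : ℝ) : ℂ) * lsum k (Int.fract β) ν α (-μ) (-2 * π * τ)) ∧
      sideSum C k α ν μ (-β) (1 / τ) =
        -(ee ((Int.fract α * μ : ℝ) : ℂ) * lsum k (Int.fract α) μ (-β) ν (-2 * π * (1 / τ))) ∧
      (2 ≤ k ∧ Int.fract α ∈ Set.Icc (0 : ℝ) 1 ∧ Int.fract β ∈ Set.Icc (0 : ℝ) 1 ∨
        Int.fract α ∈ Set.Ioo (0 : ℝ) 1 ∧ Int.fract β ∈ Set.Ioo (0 : ℝ) 1) := by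
      rcases eq_or_ne k 1 with hk1 | hk1
      · obtain ⟨hα, hβ⟩ := hk hk1
        exact ⟨sideSum_of_not_int C k _ _ _ ht hβ, sideSum_of_not_int C k _ _ _ ht' hα,
          Or.inr ⟨fract_mem_Ioo hα, fract_mem_Ioo hβ⟩⟩
      · have hk2 : 2 ≤ k := by omega
        exact ⟨sideSum_of_two_le C hk2 _ _ _ ht, sideSum_of_two_le C hk2 _ _ _ ht',
          Or.inl ⟨hk2, ⟨Int.fract_nonneg _, (Int.fract_lt_one _).le⟩,
            ⟨Int.fract_nonneg _, (Int.fract_lt_one _).le⟩⟩⟩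
    obtain ⟨h1, h2, h3⟩ := hside
    have h4 := lsum_reciprocity_fract (ε := 0)
      (by simpa only [add_zero] using lsum_reciprocity_mul_neg_I hp hq k hτ h3)
    rw [h1, h2]
    simpa only [add_zero, mul_zero] using h4

/-- Theorem 4 of the paper: the generalized Ramanujan formula (2.31). -/
theorem statement3 (α β μ ν : ℝ) (k : ℤ)
    (hk : k = 1 → (¬∃ n : ℤ, (n : ℝ) = α) ∧ (¬∃ n : ℤ, (n : ℝ) = β))
    (τ : ℂ) (hτ : 0 < τ.re)
    (C : ℕ → ℂ → ℝ → ℂ)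
    (hC : ∀ (X : ℂ) (κ : ℝ), ∀ᶠ Z in nhdsWithin (0 : ℂ) {(0 : ℂ)}ᶜ,
      HasSum (fun j : ℕ => C j X κ * Z ^ j / (Nat.factorial j : ℂ))
        (Z * ee (X * (κ : ℂ)) * Complex.exp (X * Z) / (ee ((κ : ℝ) : ℂ) * Complex.exp Z - 1))) :
    ee ((α * μ : ℝ) : ℂ) *
          (dInt β * psiIntC C k (-μ) α + Scal (k : ℂ) β (-μ) ν α τ +
            (-1 : ℂ) ^ (k - 1) * Scal (k : ℂ) (-β) μ (-ν) (-α) τ) -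
        (-2 * (Real.pi : ℂ)) ^ k *
          ∑ j ∈ Finset.range (k + 2).toNat,
            (-Complex.I) ^ j * C j ((Int.fract α : ℝ) : ℂ) μ *
                C ((k + 1).toNat - j) ((Int.fract β : ℝ) : ℂ) ν /
                ((Nat.factorial j : ℂ) * (Nat.factorial ((k + 1).toNat - j) : ℂ)) *
              τ ^ (k - (j : ℤ)) =
      ee ((β * ν : ℝ) : ℂ) * (-Complex.I * τ) ^ (k - 1) *
        (dInt α * psiIntC C k ν (-β) + Scal (k : ℂ) α ν μ (-β) (1 / τ) +
          (-1 : ℂ) ^ (k - 1) * Scal (k : ℂ) (-α) (-ν) (-μ) β (1 / τ)) := by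
  have h := sideSum_transformation hC α β μ ν k hk hτ
  rw [polyPart_bern hC] at h
  simpa only [sideSum, neg_neg] using h

end
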